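/- arXiv:1811.09210 — 6 statements merged into one kernel-verified Lean document; each statement's English description precedes it below -/
import Mathlib

section
/- Let D be a Prüfer domain in which every maximal ideal is sharp. If I is a nonzero ideal of D with (D : I) = D, then I is idempotent, i.e., I² = I. -/
/-!
Statement 0: Let `D` be a Prüfer domain in which every maximal ideal is sharp.
If `I` is a nonzero ideal of `D` with `(D : I) = D`, then `I` is idempotent, i.e. `I² = I`.
-/

noncomputable section

/-- The image of an ideal of `D` in the fraction field of `D`, as a `D`-submodule. -/
def coeI (D : Type*) [CommRing D] [IsDomain D] (I : Ideal D) :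
    Submodule D (FractionRing D) :=
  Submodule.map (Algebra.linearMap D (FractionRing D)) I

/-- `D` is a Prüfer domain: every nonzero finitely generated ideal is invertible. -/
def IsPruferDom (D : Type*) [CommRing D] [IsDomain D] : Prop :=
  ∀ F : Ideal D, F ≠ ⊥ → F.FG → coeI D F * (1 / coeI D F) = 1

/-- The localization `D_P` of `D` at a prime `P`, viewed as a subset of the fraction field:
the set of fractions `a / s` with `s ∉ P`. -/
def locSet (D : Type*) [CommRing D] [IsDomain D] (P : Ideal D) : Set (FractionRing D) :=
  {x | ∃ a s : D, s ∉ P ∧ x * algebraMap D (FractionRing D) s = algebraMap D (FractionRing D) a}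

/-- A maximal ideal `M` of `D` is sharp if `⋂ {D_N : N maximal, N ≠ M} ⊄ D_M`. -/
def IsSharpMax (D : Type*) [CommRing D] [IsDomain D] (M : Ideal D) : Prop :=
  ¬ (⋂ N ∈ {N : Ideal D | N.IsMaximal ∧ N ≠ M}, locSet D N) ⊆ locSet D M

section Auxiliary

variable {D : Type*} [CommRing D] [IsDomain D]

theorem exists_algebraMap_eq_of_forall_mem_locSet {z : FractionRing D}
    (h : ∀ N : Ideal D, N.IsMaximal → z ∈ locSet D N) :
    ∃ b : D, algebraMap D (FractionRing D) b = z := by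
  let J : Ideal D := (1 : Submodule D (FractionRing D)).comap (LinearMap.toSpanSingleton D _ z)
  have hJ : ∀ s : D, s ∈ J ↔ ∃ a, algebraMap D (FractionRing D) a = s • z := fun s ↦ by
    simp [J, Submodule.mem_one]
  have htop : J = ⊤ := by
    by_contra hne
    obtain ⟨N, hN, hJN⟩ := Ideal.exists_le_maximal J hne
    obtain ⟨a, s, hs, has⟩ := h N hN
    exact hs (hJN ((hJ s).2 ⟨a, by rw [Algebra.smul_def, mul_comm, has]⟩))
  simpa using (hJ 1).1 (htop ▸ Submodule.mem_top)

theorem mul_algebraMap_mem_locSet {N : Ideal D} {z : FractionRing D} (h : z ∈ locSet D N)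
    (d : D) : z * algebraMap D (FractionRing D) d ∈ locSet D N := by
  obtain ⟨a, s, hs, has⟩ := h
  exact ⟨a * d, s, hs, by rw [map_mul, ← has]; ring⟩

theorem mem_one_div_coeI_iff {I : Ideal D} {x : FractionRing D} :
    x ∈ (1 : Submodule D (FractionRing D)) / coeI D I ↔
      ∀ i ∈ I, ∃ b : D, algebraMap D (FractionRing D) b = x * algebraMap D _ i := by
  simp [Submodule.mem_div_iff_forall_mul_mem, coeI, Submodule.mem_one]

/-- Divisibility is total locally at a maximal ideal of a Prüfer domain. -/
theorem IsPruferDom.exists_notMem_dvd_or_dvd (hD : IsPruferDom D) {M : Ideal D}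
    (hM : M.IsMaximal) (a b : D) : ∃ s ∉ M, a ∣ s * b ∨ b ∣ s * a := by
  have h1 : (1 : D) ∉ M := (Ideal.ne_top_iff_one M).1 hM.ne_top
  by_cases ha : a = 0
  · exact ⟨1, h1, Or.inr (by simp [ha])⟩
  have hne : Ideal.span {a, b} ≠ ⊥ := fun h ↦
    ha ((Submodule.eq_bot_iff _).1 h a (Ideal.subset_span (by simp)))
  have hinv := hD _ hne (Submodule.fg_span (Set.toFinite _))
  by_contra! hcon
  have key : ∀ z ∈ coeI D (Ideal.span {a, b}) * (1 / coeI D (Ideal.span {a, b})),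
      ∃ c ∈ M, algebraMap D (FractionRing D) c = z := by
    intro z hz
    induction hz using Submodule.mul_induction_on' with
    | mem_mul_mem f hf y hy =>
      obtain ⟨f, hf, rfl⟩ := hf
      obtain ⟨u, v, rfl⟩ := Ideal.mem_span_pair.1 hf
      rw [mem_one_div_coeI_iff] at hy
      obtain ⟨p, hp⟩ := hy a (Ideal.subset_span (by simp))
      obtain ⟨q, hq⟩ := hy b (Ideal.subset_span (by simp))
      have hpq : p * b = a * q := by
        apply IsFractionRing.injective D (FractionRing D)
        rw [map_mul, map_mul, hp, hq]; ring
      refine ⟨u * p + v * q, M.add_mem (M.mul_mem_left _ ?_) (M.mul_mem_left _ ?_), ?_⟩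
      · by_contra h
        exact (hcon p h).1 ⟨q, hpq⟩
      · by_contra h
        exact (hcon q h).2 ⟨p, by linear_combination -hpq⟩
      · simp only [map_add, map_mul, hp, hq, Algebra.linearMap_apply]; ring
    | add x _ y _ hx hy =>
      obtain ⟨c, hc, rfl⟩ := hx
      obtain ⟨d, hd, rfl⟩ := hy
      exact ⟨c + d, M.add_mem hc hd, map_add _ _ _⟩
  obtain ⟨c, hc, h⟩ := key 1 (hinv.symm ▸ Submodule.one_le.1 le_rfl)
  rw [← map_one (algebraMap D (FractionRing D))] at h
  exact h1 (IsFractionRing.injective D (FractionRing D) h ▸ hc)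

/-- Locally at a sharp maximal ideal `M`, every `m ∈ M` is the product of an element of `I`
and an element of `M`, provided `(D : I) = D`. -/
theorem IsPruferDom.exists_mul_eq_mul_of_isSharpMax (hD : IsPruferDom D) {M : Ideal D}
    (hM : M.IsMaximal) (hsharp : IsSharpMax D M) {I : Ideal D}
    (hinv : (1 : Submodule D (FractionRing D)) / coeI D I = 1) {m : D} (hm : m ∈ M) :
    ∃ i ∈ I, ∃ s ∉ M, ∃ a ∈ M, s * m = i * a := by
  by_contra! hcon
  have hinj := IsFractionRing.injective D (FractionRing D)
  have h1 : (1 : D) ∉ M := (Ideal.ne_top_iff_one M).1 hM.ne_top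
  have hm0 : m ≠ 0 := fun h ↦ hcon 0 I.zero_mem 1 h1 0 M.zero_mem (by simp [h])
  have hm0' : algebraMap D (FractionRing D) m ≠ 0 := by simpa using hm0
  have hdvd : ∀ i ∈ I, ∃ s ∉ M, m ∣ s * i := by
    intro i hi
    obtain ⟨s, hs, ⟨c, hc⟩ | h⟩ := hD.exists_notMem_dvd_or_dvd hM i m
    · exact ⟨c, fun hcM ↦ hcon i hi s hs c hcM hc, s, by linear_combination -hc⟩
    · exact ⟨s, hs, h⟩
  have hdual : ∀ y : FractionRing D, (∀ N : Ideal D, N.IsMaximal → N ≠ M → y ∈ locSet D N) →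
      (∀ i ∈ I, y * algebraMap D _ i ∈ locSet D M) →
      ∃ b : D, algebraMap D (FractionRing D) b = y := by
    intro y hy hyI
    have : y ∈ (1 : Submodule D (FractionRing D)) / coeI D I := by
      refine mem_one_div_coeI_iff.2 fun i hi ↦
        exists_algebraMap_eq_of_forall_mem_locSet fun N hN ↦ ?_
      by_cases hNM : N = M
      · exact hNM ▸ hyI i hi
      · exact mul_algebraMap_mem_locSet (hy N hN hNM) i
    rw [hinv] at this
    exact Submodule.mem_one.1 this
  obtain ⟨x, hx, hxM⟩ := Set.not_subset.1 hsharp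
  replace hx : ∀ N : Ideal D, N.IsMaximal → N ≠ M → x ∈ locSet D N := fun N hN hNM ↦
    Set.mem_iInter₂.1 hx N ⟨hN, hNM⟩
  obtain ⟨i, hi, hxi⟩ : ∃ i ∈ I, x * algebraMap D _ i ∉ locSet D M := by
    by_contra! h
    obtain ⟨b, rfl⟩ := hdual x hx h
    exact hxM ⟨b, 1, h1, by simp⟩
  obtain ⟨p, q, hq, rfl⟩ := IsFractionRing.div_surjective (A := D) x
  have hq0 : algebraMap D (FractionRing D) q ≠ 0 := by
    simpa using nonZeroDivisors.ne_zero hq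
  obtain ⟨t, ht, d, htd⟩ : ∃ t ∉ M, ∃ d, t * q = p * m * d := by
    obtain ⟨s', hs', c', hc'⟩ := hdvd i hi
    obtain ⟨s, hs, ⟨c, hc⟩ | ⟨c, hc⟩⟩ := hD.exists_notMem_dvd_or_dvd hM (p * i) q
    · refine ⟨s' * s, fun h ↦ (hM.isPrime.mem_or_mem h).elim hs' hs, c' * c, ?_⟩
      linear_combination s' * hc + p * c * hc'
    · refine absurd ⟨c, s, hs, ?_⟩ hxi
      have := congrArg (algebraMap D (FractionRing D)) hc
      simp only [map_mul] at this
      field_simp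
      linear_combination this
  have hy : algebraMap D (FractionRing D) p / algebraMap D _ q * algebraMap D _ d =
      algebraMap D _ t / algebraMap D _ m := by
    have := congrArg (algebraMap D (FractionRing D)) htd
    simp only [map_mul] at this
    field_simp
    linear_combination -this
  obtain ⟨b, hb⟩ := hdual (algebraMap D _ t / algebraMap D _ m)
    (fun N hN hNM ↦ hy ▸ mul_algebraMap_mem_locSet (hx N hN hNM) d) (fun j hj ↦ by
      obtain ⟨s, hs, c, hc⟩ := hdvd j hj
      refine ⟨t * c, s, hs, ?_⟩
      have := congrArg (algebraMap D (FractionRing D)) hc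
      simp only [map_mul] at this ⊢
      field_simp
      linear_combination algebraMap D (FractionRing D) t * this)
  rw [eq_div_iff hm0', ← map_mul] at hb
  exact ht (hinj hb ▸ M.mul_mem_left b hm)

end Auxiliary

theorem statement0 (D : Type*) [CommRing D] [IsDomain D]
    (hPruf : IsPruferDom D)
    (hsharp : ∀ M : Ideal D, M.IsMaximal → IsSharpMax D M)
    (I : Ideal D) (hI : I ≠ ⊥)
    (hinv : (1 : Submodule D (FractionRing D)) / coeI D I = 1) :
    I * I = I := by
  refine le_antisymm Ideal.mul_le_left fun r hr ↦ ?_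
  by_contra hrI
  have hne : (I * I).colon {r} ≠ ⊤ := fun h ↦ hrI <| by
    have : (1 : D) ∈ (I * I).colon {r} := h ▸ Submodule.mem_top
    simpa [Submodule.mem_colon_singleton] using this
  obtain ⟨M, hM, hle⟩ := Ideal.exists_le_maximal _ hne
  have hmem : ∀ s, s * r ∈ I * I → s ∈ M := fun s hs ↦
    hle (Submodule.mem_colon_singleton.2 hs)
  have hrM : r ∈ M := hmem r (Ideal.mul_mem_mul hr hr)
  obtain ⟨i, hi, s, hs, a, ha, h⟩ :=
    hPruf.exists_mul_eq_mul_of_isSharpMax hM (hsharp M hM) hinv hrM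
  obtain ⟨j, hj, t, ht, b, -, h'⟩ :=
    hPruf.exists_mul_eq_mul_of_isSharpMax hM (hsharp M hM) hinv ha
  refine (hM.isPrime.mem_or_mem (hmem (s * t) ?_)).elim hs ht
  rw [show s * t * r = b * (i * j) by linear_combination t * h + i * h']
  exact Ideal.mul_mem_left _ _ (Ideal.mul_mem_mul hi hj)

end
end

section
/- Let D be a Prüfer domain such that every nonzero ideal I of D with (D : I) = D is idempotent. Then every branched maximal ideal of D is sharp. -/
/-! Statement 1: If D is a Prüfer domain in which every nonzero ideal I with (D : I) = D is idempotent, then every branched maximal ideal of D is sharp. -/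

noncomputable section

/-- A prime ideal `P` of `D` is branched if there is a `P`-primary ideal distinct from `P`. -/
def IsBranched (D : Type*) [CommRing D] [IsDomain D] (P : Ideal D) : Prop :=
  ∃ Q : Ideal D, Q.IsPrimary ∧ Q.radical = P ∧ Q ≠ P

/-- `D` has finite character: every nonzero element lies in only finitely many maximal ideals. -/
def FiniteCharacter (D : Type*) [CommRing D] [IsDomain D] : Prop :=
  ∀ a : D, a ≠ 0 → {M : Ideal D | M.IsMaximal ∧ a ∈ M}.Finite

/-- A nonzero ideal `I` of `D` is divisorial if `(I⁻¹)⁻¹ = I`,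
where `E⁻¹ = (D : E) = {x ∈ K : xE ⊆ D}`. -/
def IsDivisorial (D : Type*) [CommRing D] [IsDomain D] (I : Ideal D) : Prop :=
  (1 : Submodule D (FractionRing D)) / ((1 : Submodule D (FractionRing D)) / coeI D I) = coeI D I


/-- In a Prüfer domain any two elements become comparable under divisibility after multiplying
one of them by an element outside a given maximal ideal. -/
theorem IsPruferDom.exists_notMem_mul_eq (D : Type*) [CommRing D] [IsDomain D]
    (hD : IsPruferDom D) (M : Ideal D) (hM : M.IsMaximal) (a b : D) (hb : b ≠ 0) :
    ∃ s, s ∉ M ∧ ((∃ d, s * a = b * d) ∨ ∃ d, s * b = a * d) := by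
  have hinj := IsFractionRing.injective D (FractionRing D)
  have hF : Ideal.span {a, b} ≠ ⊥ := fun h =>
    hb (by simpa [h] using (Ideal.subset_span (by simp) : b ∈ Ideal.span {a, b}))
  have h := hD (Ideal.span {a, b}) hF (Submodule.fg_span (Set.toFinite _))
  have h1 : (1 : FractionRing D) ∈ coeI D (Ideal.span {a, b}) * (1 / coeI D (Ideal.span {a, b})) :=
    h.ge (Submodule.one_le.mp le_rfl)
  have hint : ∀ x ∈ 1 / coeI D (Ideal.span {a, b}), ∀ c ∈ Ideal.span {a, b},
      ∃ d, algebraMap D (FractionRing D) d = x * algebraMap D (FractionRing D) c :=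
    fun x hx c hc => Submodule.mem_one.mp (Submodule.mem_div_iff_forall_mul_mem.mp hx _ ⟨c, hc, rfl⟩)
  have hspan : coeI D (Ideal.span {a, b}) =
      Submodule.span D {algebraMap D (FractionRing D) a} ⊔
        Submodule.span D {algebraMap D (FractionRing D) b} := by
    rw [coeI, Ideal.span, Submodule.map_span, Set.image_pair, Submodule.span_insert]
    rfl
  nth_rw 1 [hspan] at h1
  rw [Submodule.sup_mul] at h1
  obtain ⟨u, hu, v, hv, huv⟩ := Submodule.mem_sup.mp h1
  obtain ⟨x, hx, rfl⟩ := Submodule.mem_span_singleton_mul.mp hu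
  obtain ⟨y, hy, rfl⟩ := Submodule.mem_span_singleton_mul.mp hv
  have ha_mem : a ∈ Ideal.span {a, b} := Ideal.subset_span (by simp)
  have hb_mem : b ∈ Ideal.span {a, b} := Ideal.subset_span (by simp)
  obtain ⟨xa, hxa⟩ := hint x hx a ha_mem
  obtain ⟨xb, hxb⟩ := hint x hx b hb_mem
  obtain ⟨ya, hya⟩ := hint y hy a ha_mem
  obtain ⟨yb, hyb⟩ := hint y hy b hb_mem
  have hsum : xa + yb = 1 := hinj (by
    rw [map_add, map_one, hxa, hyb, ← huv]; ring)
  by_cases hs : yb ∈ M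
  · refine ⟨xa, fun hxM => hM.ne_top ((Ideal.eq_top_iff_one M).mpr (hsum ▸ M.add_mem hxM hs)),
      Or.inr ⟨xb, hinj ?_⟩⟩
    rw [map_mul, map_mul, hxa, hxb]; ring
  · refine ⟨yb, hs, Or.inl ⟨ya, hinj ?_⟩⟩
    rw [map_mul, map_mul, hyb, hya]; ring

/-- An idempotent primary ideal with maximal radical in a Prüfer domain is equal to its radical. -/
theorem IsPruferDom.eq_radical_of_isPrimary_of_mul_self (D : Type*) [CommRing D] [IsDomain D]
    (hD : IsPruferDom D) (Q : Ideal D) (hQ : Q.IsPrimary) (hM : Q.radical.IsMaximal)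
    (hQQ : Q * Q = Q) : Q.radical = Q := by
  have hprim : ∀ {s x : D}, s ∉ Q.radical → s * x ∈ Q → x ∈ Q := fun {s x} hs hx =>
    ((Ideal.isPrimary_iff.mp hQ).2 (mul_comm s x ▸ hx)).resolve_right hs
  refine Ideal.IsPrime.radical ⟨(Ideal.isPrimary_iff.mp hQ).1, fun {a c} hac => ?_⟩
  by_contra! hcon
  obtain ⟨ha, hc⟩ := hcon
  have hc0 : c ≠ 0 := fun h => hc (h ▸ Q.zero_mem)
  have hdiv : ∀ q ∈ Q * Q, ∃ s, s ∉ Q.radical ∧ ∃ d ∈ Q, s * q = c * d := by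
    intro q hq
    induction hq using Submodule.mul_induction_on' with
    | mem_mul_mem x hx y hy =>
      obtain ⟨s, hs, ⟨d, hd⟩ | ⟨d, hd⟩⟩ := hD.exists_notMem_mul_eq D _ hM x c hc0
      · exact ⟨s, hs, d * y, Q.mul_mem_left d hy, by rw [← mul_assoc, hd, mul_assoc]⟩
      · exact absurd (hprim hs (hd ▸ Q.mul_mem_right d hx)) hc
    | add x _ y _ hx hy =>
      obtain ⟨s, hs, d, hdQ, hd⟩ := hx
      obtain ⟨t, ht, e, heQ, he⟩ := hy
      refine ⟨s * t, fun h => (hM.isPrime.mem_or_mem h).elim hs ht, t * d + s * e,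
        Q.add_mem (Q.mul_mem_left t hdQ) (Q.mul_mem_left s heQ), ?_⟩
      linear_combination t * hd + s * he
  obtain ⟨s, hs, d, hdQ, hd⟩ := hdiv (a * c) (hQQ.symm ▸ hac)
  have hsa : s * a = d := mul_left_cancel₀ hc0 (by linear_combination hd)
  exact ha (hprim hs (hsa ▸ hdQ))

/-- An element of the fraction field lying in the localization at every maximal ideal lies
in the domain. -/
theorem mem_one_of_forall_mem_locSet (D : Type*) [CommRing D] [IsDomain D] (x : FractionRing D)
    (hx : ∀ N : Ideal D, N.IsMaximal → x ∈ locSet D N) :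
    x ∈ (1 : Submodule D (FractionRing D)) := by
  let C : Ideal D := (1 : Submodule D (FractionRing D)).comap (LinearMap.toSpanSingleton D _ x)
  have hC : C = ⊤ := by
    by_contra hne
    obtain ⟨N, hN, hCN⟩ := Ideal.exists_le_maximal C hne
    obtain ⟨a, s, hs, has⟩ := hx N hN
    refine hs (hCN (Submodule.mem_one.mpr ⟨a, ?_⟩))
    rw [LinearMap.toSpanSingleton_apply, Algebra.smul_def, mul_comm, has]
  have h1 : (1 : D) ∈ C := hC ▸ Submodule.mem_top
  simpa [C] using h1

theorem statement1 (D : Type*) [CommRing D] [IsDomain D]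
    (hPruf : IsPruferDom D)
    (hidem : ∀ I : Ideal D, I ≠ ⊥ →
      (1 : Submodule D (FractionRing D)) / coeI D I = 1 → I * I = I)
    (M : Ideal D) (hM : M.IsMaximal) (hbr : IsBranched D M) :
    IsSharpMax D M := by
  obtain ⟨Q, hQ, rfl, hne⟩ := hbr
  intro hsub
  have hQ0 : Q ≠ ⊥ := by
    rintro rfl
    exact hne (Ideal.isPrime_bot.radical).symm
  refine hne (hPruf.eq_radical_of_isPrimary_of_mul_self D Q hQ hM (hidem Q hQ0 ?_)).symm
  refine le_antisymm (fun x hx => ?_) (Submodule.one_le.mpr ?_)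
  · have hloc : ∀ N : Ideal D, N.IsMaximal → N ≠ Q.radical → x ∈ locSet D N := by
      intro N hN hNM
      have hQN : ¬ Q ≤ N := fun h =>
        hNM (hM.eq_of_le hN.ne_top (hN.isPrime.radical_le_iff.mpr h)).symm
      obtain ⟨s, hsQ, hsN⟩ := SetLike.not_le_iff_exists.mp hQN
      obtain ⟨a, ha⟩ := Submodule.mem_one.mp
        (Submodule.mem_div_iff_forall_mul_mem.mp hx _ ⟨s, hsQ, rfl⟩)
      exact ⟨a, s, hsN, ha.symm⟩
    refine mem_one_of_forall_mem_locSet D x fun N hN => ?_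
    by_cases hNM : N = Q.radical
    · exact hNM ▸ hsub (Set.mem_iInter₂.mpr fun N' hN' => hloc N' hN'.1 hN'.2)
    · exact hloc N hN hNM
  · refine Submodule.mem_div_iff_forall_mul_mem.mpr ?_
    rintro _ ⟨q, _, rfl⟩
    exact Submodule.mem_one.mpr ⟨q, (one_mul _).symm⟩

end
end

section
/- Let D be a discrete Prüfer domain, i.e., a Prüfer domain with no nonzero branched idempotent prime ideals. Then an ideal I of D is idempotent if and only if I is a radical ideal and every prime ideal of D minimal over I is unbranched. -/
/-! Statement 3: In a discrete Prüfer domain (no nonzero branched idempotent primes), an ideal I is idempotent iff I is radical and every prime minimal over I is unbranched. -/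

noncomputable section

/-- In a Prüfer domain the localizations at primes are valuation rings: any two elements are
comparable for divisibility up to a factor outside the prime. -/
theorem IsPruferDom.exists_dvd_or_dvd {D : Type*} [CommRing D] [IsDomain D]
    (hD : IsPruferDom D) (M : Ideal D) [hM : M.IsPrime] (a b : D) :
    ∃ s ∉ M, a ∣ s * b ∨ b ∣ s * a := by
  by_cases ha : a = 0
  · exact ⟨1, M.one_notMem, Or.inr (by simp [ha])⟩
  set F : Ideal D := Ideal.span {a, b} with hF
  have haF : a ∈ F := Ideal.subset_span (by simp)
  have hbF : b ∈ F := Ideal.subset_span (by simp)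
  have hF0 : F ≠ ⊥ := fun h => ha (by simpa [h] using haF)
  have hinv := hD F hF0 (Submodule.fg_span (by simp))
  have hinj := IsFractionRing.injective D (FractionRing D)
  obtain ⟨f, hf, s, hs, hdvd⟩ : ∃ f ∈ F, ∃ s ∉ M, ∀ x ∈ F, f ∣ s * x := by
    by_contra! hcon
    have hle : coeI D F * (1 / coeI D F) ≤ coeI D M := by
      refine Submodule.mul_le.2 ?_
      rintro _ ⟨f, hf, rfl⟩ g hg
      have hg' : ∀ x ∈ F, ∃ c : D, algebraMap D (FractionRing D) c =
          g * algebraMap D (FractionRing D) x := fun x hx =>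
        Submodule.mem_one.1 (Submodule.mem_div_iff_forall_mul_mem.1 hg _ ⟨x, hx, rfl⟩)
      obtain ⟨s, hs⟩ := hg' f hf
      refine ⟨s, ?_, by simp [hs, mul_comm]⟩
      by_contra hsM
      obtain ⟨x, hx, hnd⟩ := hcon f hf s hsM
      obtain ⟨c, hc⟩ := hg' x hx
      refine hnd ⟨c, hinj ?_⟩
      rw [map_mul, map_mul, hs, hc]
      ring
    rw [hinv] at hle
    obtain ⟨m, hm, hm1⟩ := hle (Submodule.one_le.1 le_rfl)
    have : m = 1 := hinj (by simpa using hm1)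
    exact M.one_notMem (this ▸ hm)
  obtain ⟨c, hc⟩ := hdvd a haF
  obtain ⟨d, hd⟩ := hdvd b hbF
  obtain ⟨u, v, huv⟩ := Ideal.mem_span_pair.1 hf
  have hs0 : s ≠ 0 := fun h => hs (h ▸ M.zero_mem)
  have hf0 : f ≠ 0 := by
    rintro rfl
    exact mul_ne_zero hs0 ha (by simpa using hc)
  have hsum : s = u * c + v * d := mul_left_cancel₀ hf0 (by
    linear_combination (-s) * huv + u * hc + v * hd)
  by_cases hcM : c ∈ M
  · have hdM : d ∉ M := fun h =>
      hs (hsum ▸ M.add_mem (M.mul_mem_left _ hcM) (M.mul_mem_left _ h))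
    exact ⟨d * s, hM.mul_notMem hdM hs, Or.inr ⟨s * c, by linear_combination d * hc - c * hd⟩⟩
  · exact ⟨c * s, hM.mul_notMem hcM hs, Or.inl ⟨s * d, by linear_combination c * hd - d * hc⟩⟩

/-- In a Prüfer domain, the elements of `J * J` are locally multiples of squares from `J`. -/
theorem IsPruferDom.exists_mul_self_dvd {D : Type*} [CommRing D] [IsDomain D]
    (hD : IsPruferDom D) (M : Ideal D) [hM : M.IsPrime] {J : Ideal D} {x : D} (hx : x ∈ J * J) :
    ∃ f ∈ J, ∃ s ∉ M, f * f ∣ s * x := by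
  induction hx using Submodule.mul_induction_on' with
  | mem_mul_mem a ha b hb =>
    obtain ⟨t, ht, ⟨c, hc⟩ | ⟨c, hc⟩⟩ := hD.exists_dvd_or_dvd M a b
    · exact ⟨a, ha, t, ht, c, by linear_combination a * hc⟩
    · exact ⟨b, hb, t, ht, c, by linear_combination b * hc⟩
  | add x _ y _ ihx ihy =>
    obtain ⟨f, hf, s, hs, c, hc⟩ := ihx
    obtain ⟨g, hg, r, hr, d, hd⟩ := ihy
    obtain ⟨t, ht, ⟨e, he⟩ | ⟨e, he⟩⟩ := hD.exists_dvd_or_dvd M f g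
    · exact ⟨f, hf, t * t * s * r, hM.mul_notMem (hM.mul_notMem (hM.mul_notMem ht ht) hs) hr,
        t * t * r * c + s * e * e * d, by
          linear_combination t * t * r * hc + t * t * s * hd + s * d * (t * g + f * e) * he⟩
    · exact ⟨g, hg, t * t * s * r, hM.mul_notMem (hM.mul_notMem (hM.mul_notMem ht ht) hs) hr,
        t * t * s * d + r * e * e * c, by
          linear_combination t * t * r * hc + t * t * s * hd + r * c * (t * f + g * e) * he⟩

/-- Membership in an ideal can be checked locally at the maximal ideals. -/
theorem Ideal.mem_of_forall_isMaximal_exists_mul_mem {R : Type*} [CommRing R] {J : Ideal R} {x : R}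
    (h : ∀ M : Ideal R, M.IsMaximal → ∃ s ∉ M, s * x ∈ J) : x ∈ J := by
  by_contra hx
  have hne : Submodule.comap (LinearMap.toSpanSingleton R R x) J ≠ ⊤ := fun htop => hx (by
    have : (1 : R) ∈ Submodule.comap (LinearMap.toSpanSingleton R R x) J := htop ▸ Submodule.mem_top
    simpa using this)
  obtain ⟨M, hM, hle⟩ := Ideal.exists_le_maximal _ hne
  obtain ⟨s, hs, hsx⟩ := h M hM
  exact hs (hle (by simpa using hsx))

/-- The square of a prime ideal of a Prüfer domain is saturated with respect to the prime. -/
theorem IsPruferDom.mem_mul_self_of_mul_mem {D : Type*} [CommRing D] [IsDomain D]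
    (hD : IsPruferDom D) {P : Ideal D} [hP : P.IsPrime] {s x : D} (hs : s ∉ P)
    (h : s * x ∈ P * P) : x ∈ P * P := by
  have hxP : x ∈ P := (hP.mem_or_mem (Ideal.mul_le_left h)).resolve_left hs
  refine Ideal.mem_of_forall_isMaximal_exists_mul_mem fun M hM => ?_
  by_cases hPM : P ≤ M
  · obtain ⟨f, hf, r, hr, d, hd⟩ := hD.exists_mul_self_dvd M h
    obtain ⟨t, ht, ⟨c, hc⟩ | ⟨c, hc⟩⟩ := hD.exists_dvd_or_dvd M f s
    · exact absurd (hc ▸ P.mul_mem_right c hf) (hP.mul_notMem (fun h => ht (hPM h)) hs)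
    · have hcP : c ∈ P := (hP.mem_or_mem (hc ▸ P.mul_mem_left t hf)).resolve_left hs
      have hs0 : s ≠ 0 := fun h => hs (h ▸ P.zero_mem)
      refine ⟨t * r, hM.isPrime.mul_notMem ht hr, ?_⟩
      have : t * r * x = d * (c * f) := mul_left_cancel₀ hs0 (by
        linear_combination t * hd + f * d * hc)
      rw [this]
      exact Ideal.mul_mem_left _ _ (Ideal.mul_mem_mul hcP hf)
  · obtain ⟨p, hp, hpM⟩ := SetLike.not_le_iff_exists.1 hPM
    exact ⟨p, hpM, Ideal.mul_mem_mul hp hxP⟩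

/-- An unbranched prime ideal of a Prüfer domain is idempotent. -/
theorem IsPruferDom.mul_self_of_not_isBranched {D : Type*} [CommRing D] [IsDomain D]
    (hD : IsPruferDom D) {P : Ideal D} [hP : P.IsPrime] (h : ¬ IsBranched D P) : P * P = P := by
  by_contra hne
  have hrad : (P * P).radical = P := by
    rw [Ideal.radical_mul, inf_idem, hP.radical]
  refine h ⟨P * P, Ideal.isPrimary_iff.2 ⟨fun htop => hP.ne_top ?_, fun {x y} hxy => ?_⟩, hrad, hne⟩
  · exact top_le_iff.1 (htop ▸ Ideal.mul_le_left)
  · rw [hrad]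
    by_cases hy : y ∈ P
    · exact Or.inr hy
    · exact Or.inl (hD.mem_mul_self_of_mul_mem hy (mul_comm x y ▸ hxy))

/-- Idempotent ideals of a Prüfer domain are radical. -/
theorem IsPruferDom.isRadical_of_mul_self {D : Type*} [CommRing D] [IsDomain D]
    (hD : IsPruferDom D) {I : Ideal D} (hI : I * I = I) : I.IsRadical := by
  refine (Ideal.isRadical_iff_pow_one_lt 2 one_lt_two).2 fun x hx => ?_
  by_cases hx0 : x = 0
  · exact hx0 ▸ I.zero_mem
  refine Ideal.mem_of_forall_isMaximal_exists_mul_mem fun M hM => ?_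
  obtain ⟨f, hf, s, hs, d, hd⟩ := hD.exists_mul_self_dvd M (hI.symm ▸ hx)
  obtain ⟨t, ht, ⟨c, hc⟩ | ⟨c, hc⟩⟩ := hD.exists_dvd_or_dvd M f x
  · exact ⟨t, ht, hc ▸ I.mul_mem_right c hf⟩
  · refine ⟨c, fun hcM => ?_, by rw [mul_comm, ← hc]; exact I.mul_mem_left t hf⟩
    have : t * t * s = c * (c * d) := mul_right_cancel₀ (pow_ne_zero 2 hx0) (by
      linear_combination t * t * hd + d * (t * f + x * c) * hc)
    exact hM.isPrime.mul_notMem (hM.isPrime.mul_notMem ht ht) hs (this ▸ M.mul_mem_right _ hcM)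

/-- A radical ideal agrees with each of its minimal primes after localizing at that prime. -/
theorem Ideal.IsRadical.exists_mul_mem_of_mem_minimalPrimes {R : Type*} [CommRing R] {I P : Ideal R}
    (hI : I.IsRadical) (hP : P ∈ I.minimalPrimes) {x : R} (hx : x ∈ P) : ∃ s ∉ P, s * x ∈ I := by
  have := hP.1.1
  by_contra! hcon
  have hdisj : Disjoint (I : Set R) (P.primeCompl ⊔ Submonoid.powers x : Submonoid R) := by
    refine Set.disjoint_left.2 fun z hzI hz => ?_
    obtain ⟨s, hs, _, ⟨n, rfl⟩, rfl⟩ := Submonoid.mem_sup.1 hz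
    refine hcon s hs (hI ⟨n + 1, ?_⟩)
    rw [show (s * x) ^ (n + 1) = s ^ n * x * (s * x ^ n) by ring]
    exact I.mul_mem_left _ hzI
  obtain ⟨Q, hQ, hIQ, hQd⟩ := Ideal.exists_le_prime_disjoint I _ hdisj
  have hQP : Q ≤ P := fun z hz => by
    by_contra hzP
    exact Set.disjoint_left.1 hQd hz ((le_sup_left : P.primeCompl ≤ _) hzP)
  exact Set.disjoint_left.1 hQd (hP.2 ⟨hQ, hIQ⟩ hQP hx)
    ((le_sup_right : Submonoid.powers x ≤ _) (Submonoid.mem_powers x))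

/-- The zero ideal of a domain is unbranched. -/
theorem not_isBranched_bot (D : Type*) [CommRing D] [IsDomain D] : ¬ IsBranched D ⊥ := by
  rintro ⟨Q, -, hQ, hne⟩
  exact hne (le_bot_iff.1 (hQ ▸ Ideal.le_radical))

theorem statement3 (D : Type*) [CommRing D] [IsDomain D]
    (hPruf : IsPruferDom D)
    (hdisc : ∀ P : Ideal D, P.IsPrime → P ≠ ⊥ → IsBranched D P → P * P ≠ P)
    (I : Ideal D) :
    I * I = I ↔ I.radical = I ∧ ∀ P ∈ I.minimalPrimes, ¬ IsBranched D P := by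
  constructor
  · intro hI
    have hrad := hPruf.isRadical_of_mul_self hI
    refine ⟨hrad.radical, fun P hP hbr => ?_⟩
    have : P.IsPrime := hP.1.1
    refine hdisc P hP.1.1 (fun h => not_isBranched_bot D (h ▸ hbr)) hbr
      (le_antisymm Ideal.mul_le_left fun x hx => ?_)
    obtain ⟨s, hs, hsx⟩ := hrad.exists_mul_mem_of_mem_minimalPrimes hP hx
    exact hPruf.mem_mul_self_of_mul_mem hs (Ideal.mul_mono hP.1.2 hP.1.2 (hI.symm ▸ hsx))
  · rintro ⟨hI, hmin⟩
    have hrad : I.IsRadical := hI.le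
    refine le_antisymm Ideal.mul_le_left fun x hx =>
      Ideal.mem_of_forall_isMaximal_exists_mul_mem fun M hM => ?_
    by_cases hIM : I ≤ M
    · have := hM.isPrime
      obtain ⟨P, hP, hPM⟩ := Ideal.exists_minimalPrimes_le hIM
      have hPp : P.IsPrime := hP.1.1
      have hxP : x ∈ P * P := (hPruf.mul_self_of_not_isBranched (hmin P hP)).symm ▸ hP.1.2 hx
      obtain ⟨f, hf, r, hr, d, hd⟩ := hPruf.exists_mul_self_dvd M hxP
      obtain ⟨s, hs, hsf⟩ := hrad.exists_mul_mem_of_mem_minimalPrimes hP hf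
      obtain ⟨t, ht, ⟨c, hc⟩ | ⟨c, hc⟩⟩ := hPruf.exists_dvd_or_dvd M f s
      · exact absurd (hc ▸ P.mul_mem_right c hf) (hPp.mul_notMem (fun h => ht (hPM h)) hs)
      · have htf : t * f ∈ I := (Ideal.isRadical_iff_pow_one_lt 2 one_lt_two).1 hrad _ (by
          rw [show (t * f) ^ 2 = t * c * (s * f) by linear_combination t * f * hc]
          exact I.mul_mem_left _ hsf)
        refine ⟨t * t * r, hM.isPrime.mul_notMem (hM.isPrime.mul_notMem ht ht) hr, ?_⟩
        rw [show t * t * r * x = d * (t * f * (t * f)) by linear_combination t * t * hd]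
        exact Ideal.mul_mem_left _ _ (Ideal.mul_mem_mul htf htf)
    · obtain ⟨s, hs, hsM⟩ := SetLike.not_le_iff_exists.1 hIM
      exact ⟨s, hsM, Ideal.mul_mem_mul hs hx⟩
end
end

section
/- Let D be a strongly discrete Prüfer domain, i.e., a Prüfer domain with no nonzero idempotent prime ideals. Then D has no proper nonzero idempotent ideals: if I is a nonzero ideal of D with I² = I, then I = D. -/
/-! Statement 4: A strongly discrete Prüfer domain (no nonzero idempotent primes) has no proper nonzero idempotent ideals. -/

noncomputable section

theorem IsPruferDom.exists_comparison {D : Type*} [CommRing D] [IsDomain D]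
    (hD : IsPruferDom D) (a b : D) :
    ∃ p c d : D, p * b = c * a ∧ (1 - p) * a = d * b := by
  by_cases hab : Ideal.span {a, b} = ⊥
  · have ha : a = 0 := by
      rw [← Ideal.mem_bot, ← hab]; exact Ideal.subset_span (by simp)
    have hb : b = 0 := by
      rw [← Ideal.mem_bot, ← hab]; exact Ideal.subset_span (by simp)
    exact ⟨0, 0, 0, by simp [ha, hb]⟩
  have hinv := hD _ hab (Submodule.fg_span (Set.toFinite _))
  have hspan : coeI D (Ideal.span {a, b}) = Submodule.span D
      {algebraMap D (FractionRing D) a, algebraMap D (FractionRing D) b} := by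
    rw [coeI, Ideal.span, Submodule.map_span, Set.image_pair]; rfl
  rw [hspan] at hinv
  set J := Submodule.span D
    {algebraMap D (FractionRing D) a, algebraMap D (FractionRing D) b}
  have haJ : algebraMap D (FractionRing D) a ∈ J := Submodule.subset_span (by simp)
  have hbJ : algebraMap D (FractionRing D) b ∈ J := Submodule.subset_span (by simp)
  have hone : (1 : FractionRing D) ∈ J * (1 / J) := by
    rw [hinv]; exact Submodule.one_le.mp le_rfl
  have hsup : J * (1 / J) = Submodule.span D {algebraMap D (FractionRing D) a} * (1 / J) ⊔
      Submodule.span D {algebraMap D (FractionRing D) b} * (1 / J) := by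
    rw [← Submodule.sup_mul, ← Submodule.span_insert]
  rw [hsup] at hone
  obtain ⟨u, hu, v, hv, huv⟩ := Submodule.mem_sup.mp hone
  obtain ⟨x, hx, rfl⟩ := Submodule.mem_span_singleton_mul.mp hu
  obtain ⟨y, hy, rfl⟩ := Submodule.mem_span_singleton_mul.mp hv
  rw [Submodule.mem_div_iff_forall_mul_mem] at hx hy
  obtain ⟨p, hp⟩ := Submodule.mem_one.mp (hx _ haJ)
  obtain ⟨c, hc⟩ := Submodule.mem_one.mp (hx _ hbJ)
  obtain ⟨d, hd⟩ := Submodule.mem_one.mp (hy _ haJ)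
  refine ⟨p, c, d, ?_, ?_⟩ <;> apply IsFractionRing.injective D (FractionRing D) <;>
    simp only [map_mul, map_sub, map_one, hp, hc, hd]
  · ring
  · rw [← huv]; ring

theorem IsPruferDom.dvd_total_localization {D : Type*} [CommRing D] [IsDomain D]
    (hD : IsPruferDom D) (P : Ideal D) [P.IsPrime] (x y : Localization.AtPrime P) :
    x ∣ y ∨ y ∣ x := by
  obtain ⟨a, s, rfl⟩ := IsLocalization.exists_mk'_eq P.primeCompl x
  obtain ⟨b, t, rfl⟩ := IsLocalization.exists_mk'_eq P.primeCompl y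
  have hassoc (r : D) (u : P.primeCompl) :
      Associated (IsLocalization.mk' (Localization.AtPrime P) r u) (algebraMap D _ r) :=
    ⟨(IsLocalization.map_units (Localization.AtPrime P) u).unit, by simp⟩
  rw [(hassoc a s).dvd_iff_dvd_left, (hassoc b t).dvd_iff_dvd_right,
    (hassoc b t).dvd_iff_dvd_left, (hassoc a s).dvd_iff_dvd_right]
  obtain ⟨p, c, d, hpb, hpa⟩ := hD.exists_comparison a b
  have key {u v w : D} (hu : u ∉ P) (h : u * v = w) :
      algebraMap D (Localization.AtPrime P) w ∣ algebraMap D _ v := by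
    rw [← h, map_mul]
    exact (IsLocalization.map_units (Localization.AtPrime P)
      (⟨u, hu⟩ : P.primeCompl)).mul_left_dvd.mpr dvd_rfl
  by_cases hp : p ∈ P
  · right
    have hp' : 1 - p ∉ P := fun h =>
      ‹P.IsPrime›.ne_top ((Ideal.eq_top_iff_one _).mpr (by simpa using P.add_mem h hp))
    exact (map_dvd _ (Dvd.intro_left d rfl)).trans (key hp' hpa)
  · left
    exact (map_dvd _ (Dvd.intro_left c rfl)).trans (key hp hpb)

theorem Ideal.isRadical_of_mul_self_eq_of_dvd_total {R : Type*} [CommRing R] [IsDomain R]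
    (hR : ∀ x y : R, x ∣ y ∨ y ∣ x) {J : Ideal R} (hJ : J * J = J) (hne : J ≠ ⊤) :
    J.IsRadical := by
  have hsq (y : R) (hy : y ^ 2 ∈ J) : y ∈ J := by
    by_contra hyJ
    have hle : J ≤ Ideal.span {y} := fun z hz => by
      rw [Ideal.mem_span_singleton]
      exact (hR y z).resolve_right fun h => hyJ (J.mem_of_dvd h hz)
    have hcube : J ≤ Ideal.span {y ^ 2} * J :=
      calc J = J * J * J := by rw [hJ, hJ]
        _ ≤ Ideal.span {y} * Ideal.span {y} * J :=
          Ideal.mul_mono (Ideal.mul_mono hle hle) le_rfl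
        _ = Ideal.span {y ^ 2} * J := by
          rw [Ideal.span_singleton_mul_span_singleton, pow_two]
    obtain ⟨j, hj, hyj⟩ := Ideal.mem_span_singleton_mul.mp (hcube hy)
    have hy0 : y ^ 2 ≠ 0 := pow_ne_zero 2 fun h => hyJ (h ▸ J.zero_mem)
    have hj1 : j = 1 := mul_left_cancel₀ hy0 (by rw [hyj, mul_one])
    exact hne ((Ideal.eq_top_iff_one _).mpr (hj1 ▸ hj))
  have hpow (n : ℕ) (x : R) : x ^ 2 ^ n ∈ J → x ∈ J := by
    induction n with
    | zero => simp
    | succ n ih => intro h; exact ih (hsq _ (by rwa [← pow_mul, ← pow_succ]))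
  rintro x ⟨n, hn⟩
  exact hpow n x (J.pow_mem_of_pow_mem hn Nat.lt_two_pow_self.le)

theorem IsPruferDom.mul_self_eq_of_map_localization {D : Type*} [CommRing D] [IsDomain D]
    (hD : IsPruferDom D) (P : Ideal D) [P.IsPrime]
    (hP : P.map (algebraMap D (Localization.AtPrime P)) ≤
      (P * P).map (algebraMap D (Localization.AtPrime P))) : P * P = P := by
  refine le_antisymm Ideal.mul_le_left fun x hx => ?_
  obtain ⟨s, hs, hsx⟩ := (IsLocalization.algebraMap_mem_map_algebraMap_iff P.primeCompl
    (Localization.AtPrime P) _ _).mp (hP (Ideal.mem_map_of_mem _ hx))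
  have hs0 : s ≠ 0 := fun h => hs (h ▸ P.zero_mem)
  by_contra hxP
  have hcolon : (P * P).colon {x} ≠ ⊤ := fun h => hxP <| by
    simpa using Submodule.mem_colon_singleton.mp ((Ideal.eq_top_iff_one _).mp h)
  obtain ⟨M, hM, hle⟩ := Ideal.exists_le_maximal _ hcolon
  have hPM : P ≤ M := fun q hq =>
    hle (Submodule.mem_colon_singleton.mpr (Ideal.mul_mem_mul hq hx))
  have hdiv {z : D} (hz : z ∈ P * P) : ∃ t ∉ M, ∃ w ∈ P * P, t * z = w * s := by
    refine Submodule.mul_induction_on hz (fun a ha b hb => ?_) ?_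
    · obtain ⟨p, c, d, hps, hpa⟩ := hD.exists_comparison a s
      have hp : p ∈ P := (‹P.IsPrime›.mem_or_mem (hps ▸ P.mul_mem_left c ha)).resolve_right hs
      have hd : d ∈ P :=
        (‹P.IsPrime›.mem_or_mem (hpa ▸ P.mul_mem_left (1 - p) ha)).resolve_right hs
      refine ⟨1 - p, fun h => hM.ne_top ((Ideal.eq_top_iff_one _).mpr
        (by simpa using M.add_mem h (hPM hp))), d * b, Ideal.mul_mem_mul hd hb, ?_⟩
      linear_combination b * hpa
    · rintro y z ⟨t, ht, w, hw, h⟩ ⟨t', ht', w', hw', h'⟩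
      refine ⟨t * t', fun hmem => (hM.isPrime.mem_or_mem hmem).elim ht ht', t' * w + t * w',
        add_mem (Ideal.mul_mem_left _ _ hw) (Ideal.mul_mem_left _ _ hw'), ?_⟩
      linear_combination t' * h + t * h'
  obtain ⟨t, ht, w, hw, h⟩ := hdiv hsx
  have htx : t * x = w := mul_right_cancel₀ hs0 (by linear_combination h)
  exact ht (hle (Submodule.mem_colon_singleton.mpr (by rwa [smul_eq_mul, htx])))

theorem statement4 (D : Type*) [CommRing D] [IsDomain D]
    (hPruf : IsPruferDom D)
    (hsd : ∀ P : Ideal D, P.IsPrime → P ≠ ⊥ → P * P ≠ P)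
    (I : Ideal D) (hI : I ≠ ⊥) (hidem : I * I = I) :
    I = ⊤ := by
  by_contra hne
  obtain ⟨M, hM, hIM⟩ := Ideal.exists_le_maximal I hne
  have : M.IsPrime := hM.isPrime
  obtain ⟨P, hPmin, -⟩ := Ideal.exists_minimalPrimes_le hIM
  have hP : P.IsPrime := hPmin.1.1
  have hIP : I ≤ P := hPmin.1.2
  refine hsd P hP (fun h => hI (le_bot_iff.mp (h ▸ hIP))) ?_
  refine hPruf.mul_self_eq_of_map_localization P ?_
  set f := algebraMap D (Localization.AtPrime P)
  have hmap : I.map f * I.map f = I.map f := by rw [← Ideal.map_mul, hidem]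
  have hPmap : P.map f = IsLocalRing.maximalIdeal (Localization.AtPrime P) :=
    Localization.AtPrime.map_eq_maximalIdeal
  have hIne : I.map f ≠ ⊤ := fun h => (IsLocalRing.maximalIdeal.isMaximal _).ne_top
    (top_le_iff.mp (h ▸ hPmap ▸ Ideal.map_mono hIP))
  have hrad := (Ideal.isRadical_of_mul_self_eq_of_dvd_total
    (hPruf.dvd_total_localization P) hmap hIne).radical
  rw [← IsLocalization.AtPrime.radical_map_of_mem_minimalPrimes (Localization.AtPrime P) P I hPmin,
    hrad, ← hmap, ← Ideal.map_mul]
  exact Ideal.map_mono (Ideal.mul_mono hIP hIP)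

end
end

section
/- Let D be a Prüfer domain with finite character and let I be a nonzero proper ideal of D. Then the following are equivalent: (a) I is idempotent and divisorial; (b) I is a product of finitely many non-maximal idempotent prime ideals of D; (c) I is a product of finitely many divisorial idempotent prime ideals of D. -/
/-! Statement 6: In a Prüfer domain with finite character, for a nonzero proper ideal I, TFAE: (a) I idempotent and divisorial; (b) I is a product of non-maximal idempotent primes; (c) I is a product of divisorial idempotent primes. -/

noncomputable section

section LocalMembership

variable {D : Type*} [CommRing D]

/-- The contraction to `D` of the localization of the ideal `I` at the prime `M`. -/
def localContraction (M I : Ideal D) [hM : M.IsPrime] : Ideal D where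
  carrier := {a | ∃ s ∉ M, s * a ∈ I}
  zero_mem' := ⟨1, M.one_notMem, by simp⟩
  add_mem' := by
    rintro a b ⟨s, hs, hsa⟩ ⟨t, ht, htb⟩
    refine ⟨s * t, hM.mul_notMem hs ht, ?_⟩
    have : s * t * (a + b) = t * (s * a) + s * (t * b) := by ring
    rw [this]
    exact I.add_mem (I.mul_mem_left _ hsa) (I.mul_mem_left _ htb)
  smul_mem' := by
    rintro c a ⟨s, hs, hsa⟩
    refine ⟨s, hs, ?_⟩
    have : s * (c • a) = c * (s * a) := by simp only [smul_eq_mul]; ring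
    rw [this]
    exact I.mul_mem_left _ hsa

theorem mem_localContraction {M I : Ideal D} [M.IsPrime] {a : D} :
    a ∈ localContraction M I ↔ ∃ s ∉ M, s * a ∈ I := Iff.rfl

theorem le_localContraction (M I : Ideal D) [M.IsPrime] : I ≤ localContraction M I :=
  fun a ha => ⟨1, M.one_notMem, by simpa using ha⟩

theorem localContraction_le {M I P : Ideal D} [M.IsPrime] (hP : P.IsPrime) (hPM : P ≤ M)
    (hIP : I ≤ P) : localContraction M I ≤ P := by
  rintro a ⟨s, hs, hsa⟩
  exact (hP.mem_or_mem (hIP hsa)).resolve_left fun h => hs (hPM h)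

theorem mem_of_mem_localContraction {I : Ideal D} {a : D}
    (h : ∀ (M : Ideal D) [M.IsMaximal], a ∈ localContraction M I) : a ∈ I := by
  by_contra ha
  have hne : I.colon {a} ≠ ⊤ := by
    intro htop
    have h1 : (1 : D) ∈ I.colon {a} := htop ▸ Submodule.mem_top
    rw [Submodule.mem_colon_singleton] at h1
    exact ha (by simpa using h1)
  obtain ⟨M, hM, hle⟩ := Ideal.exists_le_maximal _ hne
  obtain ⟨s, hs, hsa⟩ := h M
  exact hs (hle (by rw [Submodule.mem_colon_singleton]; simpa using hsa))

end LocalMembership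

section Prufer

variable {D : Type*} [CommRing D] [IsDomain D]

theorem algebraMap_mem_coeI {I : Ideal D} {a : D} :
    algebraMap D (FractionRing D) a ∈ coeI D I ↔ a ∈ I := by
  constructor
  · rintro ⟨b, hb, h⟩
    rwa [← IsFractionRing.injective D (FractionRing D) h]
  · exact fun h => ⟨a, h, rfl⟩

theorem mem_one_div_coeI {I : Ideal D} {x : FractionRing D} :
    x ∈ 1 / coeI D I ↔ ∀ a ∈ I, ∃ d : D,
      algebraMap D (FractionRing D) d = x * algebraMap D (FractionRing D) a := by
  rw [Submodule.mem_div_iff_forall_mul_mem]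
  simp only [Submodule.mem_one]
  constructor
  · exact fun h a ha => h _ (algebraMap_mem_coeI.2 ha)
  · rintro h _ ⟨a, ha, rfl⟩
    exact h a ha

/-- Membership form of divisoriality: `I` contains every `a ∈ D` with `a I⁻¹ ⊆ D`. -/
theorem isDivisorial_iff {I : Ideal D} :
    IsDivisorial D I ↔ ∀ a : D, (∀ x ∈ 1 / coeI D I, ∃ d : D,
      algebraMap D (FractionRing D) d = x * algebraMap D (FractionRing D) a) → a ∈ I := by
  have key : ∀ a : D, algebraMap D (FractionRing D) a ∈
      (1 : Submodule D (FractionRing D)) / (1 / coeI D I) ↔ ∀ x ∈ 1 / coeI D I, ∃ d : D,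
      algebraMap D (FractionRing D) d = x * algebraMap D (FractionRing D) a := by
    intro a
    rw [Submodule.mem_div_iff_forall_mul_mem]
    simp only [Submodule.mem_one, mul_comm]
  unfold IsDivisorial
  constructor
  · intro h a ha
    rw [← algebraMap_mem_coeI, ← h]
    exact (key a).2 ha
  · intro h
    apply le_antisymm
    · intro y hy
      have hone : (1 : FractionRing D) ∈ 1 / coeI D I :=
        mem_one_div_coeI.2 fun a _ => ⟨a, by simp⟩
      obtain ⟨a, rfl⟩ := Submodule.mem_one.1
        (by simpa using Submodule.mem_div_iff_forall_mul_mem.1 hy 1 hone)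
      exact algebraMap_mem_coeI.2 (h a ((key a).1 hy))
    · rintro _ ⟨a, ha, rfl⟩
      exact (key a).2 fun x hx => mem_one_div_coeI.1 hx a ha

theorem isDivisorial_top : IsDivisorial D ⊤ := isDivisorial_iff.2 fun _ _ => Submodule.mem_top

theorem IsDivisorial.inf {A B : Ideal D} (hA : IsDivisorial D A) (hB : IsDivisorial D B) :
    IsDivisorial D (A ⊓ B) := by
  rw [isDivisorial_iff] at *
  intro a ha
  constructor
  · exact hA a fun x hx => ha x (mem_one_div_coeI.2 fun b hb => mem_one_div_coeI.1 hx b hb.1)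
  · exact hB a fun x hx => ha x (mem_one_div_coeI.2 fun b hb => mem_one_div_coeI.1 hx b hb.2)

theorem isDivisorial_of_invertible {F : Ideal D} (hF : coeI D F * (1 / coeI D F) = 1) :
    IsDivisorial D F := by
  rw [isDivisorial_iff]
  intro a ha
  have h : ∀ y ∈ coeI D F * (1 / coeI D F),
      y * algebraMap D (FractionRing D) a ∈ coeI D F := by
    intro y hy
    induction hy using Submodule.mul_induction_on' with
    | mem_mul_mem f hf x hx =>
      obtain ⟨d, hd⟩ := ha x hx
      rw [mul_assoc, ← hd, mul_comm, ← Algebra.smul_def]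
      exact Submodule.smul_mem _ _ hf
    | add y _ z _ hy hz =>
      rw [add_mul]
      exact Submodule.add_mem _ hy hz
  rw [hF] at h
  simpa [algebraMap_mem_coeI] using h 1 (Submodule.one_le.1 le_rfl)

/-- Divisibility is total in the localization of a Prüfer domain at a prime. -/
theorem IsPruferDom.exists_notMem_dvd (hD : IsPruferDom D) (M : Ideal D) [hM : M.IsPrime]
    (a b : D) : ∃ s ∉ M, a ∣ s * b ∨ b ∣ s * a := by
  by_cases hab : Ideal.span {a, b} = ⊥
  · have : a = 0 := by
      rw [← Ideal.mem_bot, ← hab]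
      exact Ideal.subset_span (by simp)
    exact ⟨1, M.one_notMem, Or.inr (by simp [this])⟩
  have hinv := hD _ hab (Submodule.fg_span (Set.toFinite {a, b}))
  by_contra! hcon
  have hle : coeI D (Ideal.span {a, b}) * (1 / coeI D (Ideal.span {a, b})) ≤ coeI D M := by
    rw [Submodule.mul_le]
    rintro _ ⟨f, hf, rfl⟩ x hx
    obtain ⟨u, v, rfl⟩ := Ideal.mem_span_pair.1 hf
    obtain ⟨α, hα⟩ := mem_one_div_coeI.1 hx a (Ideal.subset_span (by simp))
    obtain ⟨β, hβ⟩ := mem_one_div_coeI.1 hx b (Ideal.subset_span (by simp))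
    have hcross : α * b = β * a := by
      apply IsFractionRing.injective D (FractionRing D)
      rw [map_mul, map_mul, hα, hβ]
      ring
    have hαM : α ∈ M := by
      by_contra h
      exact (hcon α h).1 ⟨β, by rw [hcross, mul_comm]⟩
    have hβM : β ∈ M := by
      by_contra h
      exact (hcon β h).2 ⟨α, by rw [← hcross, mul_comm]⟩
    have heq : Algebra.linearMap D (FractionRing D) (u * a + v * b) * x =
        algebraMap D (FractionRing D) (u * α + v * β) := by
      simp only [Algebra.linearMap_apply, map_add, map_mul, hα, hβ]
      ring
    rw [heq, algebraMap_mem_coeI]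
    exact M.add_mem (M.mul_mem_left _ hαM) (M.mul_mem_left _ hβM)
  rw [hinv, Submodule.one_le, ← map_one (algebraMap D (FractionRing D)),
    algebraMap_mem_coeI] at hle
  exact M.one_notMem hle

theorem IsPruferDom.le_total_of_le (hD : IsPruferDom D) {M P Q : Ideal D} [M.IsPrime]
    (hP : P.IsPrime) (hQ : Q.IsPrime) (hPM : P ≤ M) (hQM : Q ≤ M) : P ≤ Q ∨ Q ≤ P := by
  by_contra! h
  obtain ⟨p, hp, hpQ⟩ := SetLike.not_le_iff_exists.1 h.1
  obtain ⟨q, hq, hqP⟩ := SetLike.not_le_iff_exists.1 h.2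
  obtain ⟨s, hs, hd | hd⟩ := hD.exists_notMem_dvd M p q
  · exact (hP.mul_notMem (fun h' => hs (hPM h')) hqP) (Ideal.mem_of_dvd _ hd hp)
  · exact (hQ.mul_notMem (fun h' => hs (hQM h')) hpQ) (Ideal.mem_of_dvd _ hd hq)

/-- Idempotent ideals of a Prüfer domain are locally prime. -/
theorem IsPruferDom.isPrime_localContraction (hD : IsPruferDom D) {M I : Ideal D}
    [hM : M.IsPrime] (hI : I * I = I) (hIM : I ≤ M) : (localContraction M I).IsPrime := by
  have hrad : ∀ b, b * b ∈ localContraction M I → b ∈ localContraction M I := by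
    rintro b ⟨s, hs, hsb⟩
    by_contra hb
    have hmul : I ≤ localContraction M (Ideal.span {b} * I) := by
      nth_rewrite 1 [← hI]
      rw [Ideal.mul_le]
      intro x hx y hy
      obtain ⟨t, ht, hd | ⟨d, hd⟩⟩ := hD.exists_notMem_dvd M x b
      · exact absurd ⟨t, ht, Ideal.mem_of_dvd _ hd hx⟩ hb
      · refine ⟨t, ht, Ideal.mem_span_singleton_mul.2 ⟨d * y, I.mul_mem_left _ hy, ?_⟩⟩
        linear_combination -y * hd
    obtain ⟨t, ht, h⟩ := hmul hsb
    obtain ⟨i, hi, hie⟩ := Ideal.mem_span_singleton_mul.1 h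
    have hb0 : b ≠ 0 := by
      rintro rfl
      exact hb (Submodule.zero_mem _)
    refine hb ⟨t * s, hM.mul_notMem ht hs, ?_⟩
    have : t * s * b = i := mul_left_cancel₀ hb0 (by linear_combination -hie)
    rwa [this]
  refine ⟨fun h => M.one_notMem (localContraction_le hM le_rfl hIM
    (h ▸ Submodule.mem_top : (1 : D) ∈ localContraction M I)), ?_⟩
  rintro a b ⟨s, hs, hsab⟩
  obtain ⟨t, ht, ⟨d, hd⟩ | ⟨d, hd⟩⟩ := hD.exists_notMem_dvd M a b
  · refine Or.inr (hrad b ⟨s * t, hM.mul_notMem hs ht, ?_⟩)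
    have : s * t * (b * b) = d * (s * (a * b)) := by linear_combination s * b * hd
    rw [this]
    exact I.mul_mem_left _ hsab
  · refine Or.inl (hrad a ⟨s * t, hM.mul_notMem hs ht, ?_⟩)
    have : s * t * (a * a) = d * (s * (a * b)) := by linear_combination s * a * hd
    rw [this]
    exact I.mul_mem_left _ hsab

theorem IsPruferDom.mul_eq_inf (hD : IsPruferDom D) {A B : Ideal D} (hA : A * A = A)
    (hB : B * B = B) : A * B = A ⊓ B := by
  refine le_antisymm Ideal.mul_le_inf fun x hx => mem_of_mem_localContraction fun M _ => ?_
  by_cases hAM : A ≤ M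
  · by_cases hBM : B ≤ M
    · have hmul : ∀ A B : Ideal D, A * A = A → localContraction M A ≤ localContraction M B →
          A ≤ localContraction M (A * B) := by
        intro A B hA hle
        nth_rewrite 1 [← hA]
        rw [Ideal.mul_le]
        intro a ha b hb
        obtain ⟨t, ht, htb⟩ := hle (le_localContraction M A hb)
        refine ⟨t, ht, ?_⟩
        rw [mul_left_comm]
        exact Ideal.mul_mem_mul ha htb
      have hM : M.IsPrime := inferInstance
      rcases hD.le_total_of_le (hD.isPrime_localContraction (M := M) hA hAM)
        (hD.isPrime_localContraction (M := M) hB hBM) (localContraction_le hM le_rfl hAM)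
        (localContraction_le hM le_rfl hBM) with h | h
      · exact hmul A B hA h hx.1
      · rw [mul_comm A B]
        exact hmul B A hB h hx.2
    · obtain ⟨b, hb, hbM⟩ := SetLike.not_le_iff_exists.1 hBM
      exact ⟨b, hbM, by rw [mul_comm b]; exact Ideal.mul_mem_mul hx.1 hb⟩
  · obtain ⟨a, ha, haM⟩ := SetLike.not_le_iff_exists.1 hAM
    exact ⟨a, haM, Ideal.mul_mem_mul ha hx.2⟩

theorem IsPruferDom.idempotent_localContraction (hD : IsPruferDom D) {M I : Ideal D}
    [hM : M.IsPrime] (hI : I * I = I) (hIM : I ≤ M) :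
    localContraction M I * localContraction M I = localContraction M I := by
  have hP := hD.isPrime_localContraction hI hIM
  refine le_antisymm Ideal.mul_le_left fun a ha => mem_of_mem_localContraction fun N _ => ?_
  have hN : N.IsPrime := inferInstance
  by_cases hPN : localContraction M I ≤ N
  · have hIN : I ≤ N := (le_localContraction M I).trans hPN
    have hQ := hD.isPrime_localContraction (M := N) hI hIN
    have hle : localContraction M I ≤ localContraction N I := by
      rcases hD.le_total_of_le hP hQ hPN (localContraction_le hN le_rfl hIN) with h | h
      · exact h
      · exact localContraction_le hQ (h.trans (localContraction_le hM le_rfl hIM))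
          (le_localContraction N I)
    obtain ⟨s, hs, hsa⟩ := hle ha
    rw [← hI] at hsa
    exact ⟨s, hs, Ideal.mul_mono (le_localContraction M I) (le_localContraction M I) hsa⟩
  · obtain ⟨p, hp, hpN⟩ := SetLike.not_le_iff_exists.1 hPN
    exact ⟨p, hpN, Ideal.mul_mem_mul hp ha⟩

/-- The inverse of an idempotent maximal ideal of a Prüfer domain is trivial. -/
theorem IsPruferDom.exists_algebraMap_eq_of_mem_one_div (hD : IsPruferDom D) {M : Ideal D}
    [hmax : M.IsMaximal] (hM : M * M = M) {x : FractionRing D} (hx : x ∈ 1 / coeI D M) :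
    ∃ d : D, algebraMap D (FractionRing D) d = x := by
  obtain ⟨b, c, hc, rfl⟩ := IsFractionRing.div_surjective (A := D) x
  have hc0 : c ≠ 0 := nonZeroDivisors.ne_zero hc
  have hc0' : algebraMap D (FractionRing D) c ≠ 0 := by simpa using hc0
  have hmem : ∀ m ∈ M, ∃ d, d * c = b * m := by
    intro m hm
    obtain ⟨d, hd⟩ := mem_one_div_coeI.1 hx m hm
    refine ⟨d, IsFractionRing.injective D (FractionRing D) ?_⟩
    rw [map_mul, map_mul, hd]
    field_simp
  have hmul : ∀ m ∈ M, ∃ d ∈ M, d * c = b * m := by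
    intro m hm
    rw [← hM] at hm
    induction hm using Submodule.mul_induction_on' with
    | mem_mul_mem m hm n hn =>
      obtain ⟨d, hd⟩ := hmem m hm
      exact ⟨d * n, M.mul_mem_left _ hn, by linear_combination n * hd⟩
    | add m _ n _ hm hn =>
      obtain ⟨d, hd, hdm⟩ := hm
      obtain ⟨e, he, hen⟩ := hn
      exact ⟨d + e, M.add_mem hd he, by linear_combination hdm + hen⟩
  have hb : b ∈ Ideal.span {c} := by
    refine mem_of_mem_localContraction fun N hN => ?_
    by_cases hNM : M ≤ N
    · obtain rfl := hmax.eq_of_le hN.ne_top hNM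
      obtain ⟨s, hs, hd | ⟨d, hd⟩⟩ := hD.exists_notMem_dvd M c b
      · exact ⟨s, hs, Ideal.mem_span_singleton.2 hd⟩
      · by_cases hdM : d ∈ M
        · obtain ⟨e, he, hed⟩ := hmul d hdM
          have : e = s := mul_right_cancel₀ hc0 (by rw [hed, hd])
          exact absurd (this ▸ he) hs
        · refine ⟨d, hdM, Ideal.mem_span_singleton.2 ⟨s, ?_⟩⟩
          linear_combination -hd
    · obtain ⟨m, hm, hmN⟩ := SetLike.not_le_iff_exists.1 hNM
      obtain ⟨d, hd⟩ := hmem m hm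
      exact ⟨m, hmN, Ideal.mem_span_singleton.2 ⟨d, by linear_combination -hd⟩⟩
  obtain ⟨d, rfl⟩ := Ideal.mem_span_singleton.1 hb
  exact ⟨d, by rw [map_mul]; field_simp⟩

theorem IsPruferDom.isDivisorial_of_not_isMaximal (hD : IsPruferDom D)
    (hfc : FiniteCharacter D) {P : Ideal D} (hP : P.IsPrime) (hP0 : P ≠ ⊥)
    (hPmax : ¬ P.IsMaximal) : IsDivisorial D P := by
  obtain ⟨p, hp, hp0⟩ := Submodule.exists_mem_ne_zero_of_ne_bot hP0
  obtain ⟨q, hq, hqN⟩ : ∃ q ∈ P, ∀ N : Ideal D, N.IsMaximal → p ∈ N → ¬ P ≤ N → q ∉ N := by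
    have hfin : {N : Ideal D | (N.IsMaximal ∧ p ∈ N) ∧ ¬ P ≤ N}.Finite :=
      (hfc p hp0).subset fun N hN => hN.1
    by_contra! h
    have hsub : (P : Set D) ⊆ ⋃ N ∈ hfin.toFinset, (N : Set D) := by
      intro q hq
      obtain ⟨N, h1, h2, h3, h4⟩ := h q hq
      simp only [Set.mem_iUnion]
      exact ⟨N, by simpa using ⟨⟨h1, h2⟩, h3⟩, h4⟩
    obtain ⟨N, hN, hle⟩ := (Ideal.subset_union_prime (f := id) ⊥ ⊥ (fun N hN _ _ =>
      (by simpa using hN : (N.IsMaximal ∧ p ∈ N) ∧ ¬ P ≤ N).1.1.isPrime)).1 hsub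
    exact (by simpa using hN : (N.IsMaximal ∧ p ∈ N) ∧ ¬ P ≤ N).2 hle
  obtain ⟨M, hM, hPM⟩ := Ideal.exists_le_maximal P hP.ne_top
  obtain ⟨m, hmM, hmP⟩ := SetLike.not_le_iff_exists.1
    (fun h : M ≤ P => hPmax (le_antisymm hPM h ▸ hM))
  rw [isDivisorial_iff]
  intro a ha
  by_contra haP
  have ham : a * m ∉ P := hP.mul_notMem haP hmP
  have hloc : ∀ (N : Ideal D) [N.IsPrime], P ≤ N →
      P ≤ localContraction N (Ideal.span {a * m}) := by
    intro N _ hPN x hx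
    obtain ⟨s, hs, hd | hd⟩ := hD.exists_notMem_dvd N x (a * m)
    · exact absurd (Ideal.mem_of_dvd _ hd hx) (hP.mul_notMem (fun h => hs (hPN h)) ham)
    · exact ⟨s, hs, Ideal.mem_span_singleton.2 hd⟩
  set T : Ideal D := Ideal.span {p, q, a * m} with hT
  have hpT : p ∈ T := Ideal.subset_span (by simp)
  have hqT : q ∈ T := Ideal.subset_span (by simp)
  have hamT : a * m ∈ T := Ideal.subset_span (by simp)
  have hPT : P ≤ T := by
    refine fun x hx => mem_of_mem_localContraction fun N hN => ?_
    by_cases hPN : P ≤ N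
    · obtain ⟨s, hs, h⟩ := hloc N hPN hx
      exact ⟨s, hs, (Ideal.span_singleton_le_iff_mem T).2 hamT h⟩
    · by_cases hpN : p ∈ N
      · exact ⟨q, hqN N hN hpN hPN, T.mul_mem_right _ hqT⟩
      · exact ⟨p, hpN, T.mul_mem_right _ hpT⟩
  have hT0 : T ≠ ⊥ := fun h => hp0 (by simpa [h] using hpT)
  have hTdiv := isDivisorial_of_invertible (hD T hT0
    (Submodule.fg_span (Set.toFinite {p, q, a * m})))
  have haT : a ∈ T := isDivisorial_iff.1 hTdiv a fun x hx =>
    ha x (mem_one_div_coeI.2 fun b hb => mem_one_div_coeI.1 hx b (hPT hb))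
  have hTM : T ≤ localContraction M (Ideal.span {a * m}) := by
    rw [hT, Ideal.span_le]
    rintro x (rfl | rfl | rfl)
    · exact hloc M hPM hp
    · exact hloc M hPM hq
    · exact le_localContraction _ _ (Ideal.mem_span_singleton_self _)
  obtain ⟨s, hs, h⟩ := hTM haT
  obtain ⟨d, hd⟩ := Ideal.mem_span_singleton.1 h
  have ha0 : a ≠ 0 := fun h => haP (h ▸ P.zero_mem)
  have : s = m * d := mul_right_cancel₀ ha0 (by linear_combination hd)
  exact hs (this ▸ M.mul_mem_right _ hmM)

theorem IsPruferDom.prod_idempotent_isDivisorial (hD : IsPruferDom D)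
    (s : Multiset (Ideal D)) (hs : ∀ P ∈ s, P * P = P ∧ IsDivisorial D P) :
    s.prod * s.prod = s.prod ∧ IsDivisorial D s.prod := by
  refine Multiset.prod_induction (fun P : Ideal D => P * P = P ∧ IsDivisorial D P) s
    (fun A B hA hB => ⟨by rw [mul_mul_mul_comm, hA.1, hB.1], ?_⟩)
    ⟨mul_one 1, Ideal.one_eq_top (R := D) ▸ isDivisorial_top⟩ hs
  rw [hD.mul_eq_inf hA.1 hB.1]
  exact hA.2.inf hB.2

theorem IsPruferDom.finset_prod_eq_inf (hD : IsPruferDom D) {ι : Type*} (s : Finset ι)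
    (f : ι → Ideal D) (hf : ∀ i ∈ s, f i * f i = f i) :
    ∏ i ∈ s, f i = s.inf f ∧ (∏ i ∈ s, f i) * (∏ i ∈ s, f i) = ∏ i ∈ s, f i := by
  classical
  induction s using Finset.induction_on with
  | empty => simp
  | insert i s hi ih =>
    obtain ⟨h1, h2⟩ := ih fun j hj => hf j (Finset.mem_insert_of_mem hj)
    have h3 := hf i (Finset.mem_insert_self i s)
    rw [Finset.prod_insert hi, Finset.inf_insert, ← h1, mul_mul_mul_comm, h2, h3]
    exact ⟨hD.mul_eq_inf h3 h2, rfl⟩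

theorem IsPruferDom.exists_multiset_prod_eq (hD : IsPruferDom D) (hfc : FiniteCharacter D)
    {I : Ideal D} (hI0 : I ≠ ⊥) (hI : I * I = I) (hdiv : IsDivisorial D I) :
    ∃ s : Multiset (Ideal D),
      (∀ P ∈ s, P.IsPrime ∧ ¬ P.IsMaximal ∧ P * P = P) ∧ s.prod = I := by
  classical
  have hfin : {M : MaximalSpectrum D | I ≤ M.asIdeal}.Finite := by
    obtain ⟨a, ha, ha0⟩ := Submodule.exists_mem_ne_zero_of_ne_bot hI0
    exact ((hfc a ha0).preimage (f := MaximalSpectrum.asIdeal)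
      fun M _ N _ h => MaximalSpectrum.ext h).subset fun M hM => ⟨M.isMaximal, hM ha⟩
  have hS : ∀ M, M ∈ hfin.toFinset ↔ I ≤ M.asIdeal := by simp
  generalize hfin.toFinset = S at hS
  let f : MaximalSpectrum D → Ideal D := fun M =>
    haveI := M.isMaximal.isPrime; localContraction M.asIdeal I
  have hidem : ∀ M ∈ S, f M * f M = f M := fun M hM =>
    haveI := M.isMaximal.isPrime; hD.idempotent_localContraction hI ((hS M).1 hM)
  have hprime : ∀ M ∈ S, (f M).IsPrime := fun M hM =>
    haveI := M.isMaximal.isPrime; hD.isPrime_localContraction hI ((hS M).1 hM)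
  have hle : ∀ M ∈ S, f M ≤ M.asIdeal := fun M hM =>
    haveI := M.isMaximal.isPrime
    localContraction_le M.isMaximal.isPrime le_rfl ((hS M).1 hM)
  have hge : ∀ M, I ≤ f M := fun M =>
    haveI := M.isMaximal.isPrime; le_localContraction M.asIdeal I
  have hprod : ∏ M ∈ S, f M = I := by
    rw [(hD.finset_prod_eq_inf S f hidem).1]
    refine le_antisymm (fun x hx => mem_of_mem_localContraction fun N hN => ?_)
      (Finset.le_inf fun M _ => hge M)
    by_cases hIN : I ≤ N
    · have hinf : S.inf f ≤ f ⟨N, hN⟩ := Finset.inf_le ((hS ⟨N, hN⟩).2 hIN)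
      exact hinf hx
    · obtain ⟨i, hi, hiN⟩ := SetLike.not_le_iff_exists.1 hIN
      exact mem_localContraction.2 ⟨i, hiN, I.mul_mem_right _ hi⟩
  refine ⟨S.val.map f, ?_, hprod⟩
  intro P hP
  obtain ⟨M, hM, rfl⟩ := Multiset.mem_map.1 hP
  rw [Finset.mem_val] at hM
  refine ⟨hprime M hM, fun hmax => ?_, hidem M hM⟩
  have hfM : f M = M.asIdeal := hmax.eq_of_le M.isMaximal.ne_top (hle M hM)
  have hJ : ∏ N ∈ S.erase M, f N ≤ f M := by
    refine fun j hj => hge M (isDivisorial_iff.1 hdiv j fun x hx => ?_)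
    refine hD.exists_algebraMap_eq_of_mem_one_div (hidem M hM)
      (mem_one_div_coeI.2 fun m hm => ?_)
    have hjm : m * j ∈ I := by
      rw [← hprod, ← Finset.mul_prod_erase S f hM]
      exact Ideal.mul_mem_mul hm hj
    obtain ⟨d, hd⟩ := mem_one_div_coeI.1 hx _ hjm
    exact ⟨d, by rw [hd, map_mul]; ring⟩
  obtain ⟨N, hN, hNM⟩ := ((hprime M hM).prod_le).1 hJ
  obtain ⟨hne, hNS⟩ := Finset.mem_erase.1 hN
  have hMN : f M ≤ f N :=
    haveI := M.isMaximal.isPrime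
    localContraction_le (hprime N hNS) (hNM.trans (hle M hM)) (hge N)
  exact hne (MaximalSpectrum.ext (M.isMaximal.eq_of_le N.isMaximal.ne_top
    (hfM ▸ hMN.trans (hle N hNS))).symm)

end Prufer

theorem statement6 (D : Type*) [CommRing D] [IsDomain D]
    (hPruf : IsPruferDom D) (hfc : FiniteCharacter D)
    (I : Ideal D) (hI0 : I ≠ ⊥) (hItop : I ≠ ⊤) :
    ((I * I = I ∧ IsDivisorial D I) ↔
      ∃ s : Multiset (Ideal D),
        (∀ P ∈ s, P.IsPrime ∧ ¬ P.IsMaximal ∧ P * P = P) ∧ s.prod = I) ∧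
    ((I * I = I ∧ IsDivisorial D I) ↔
      ∃ s : Multiset (Ideal D),
        (∀ P ∈ s, P.IsPrime ∧ IsDivisorial D P ∧ P * P = P) ∧ s.prod = I) := by
  have hbc : ∀ s : Multiset (Ideal D),
      (∀ P ∈ s, P.IsPrime ∧ ¬ P.IsMaximal ∧ P * P = P) → s.prod = I →
      ∀ P ∈ s, P.IsPrime ∧ IsDivisorial D P ∧ P * P = P := by
    intro s hs hsI P hP
    obtain ⟨h1, h2, h3⟩ := hs P hP
    refine ⟨h1, hPruf.isDivisorial_of_not_isMaximal hfc h1 ?_ h2, h3⟩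
    rintro rfl
    exact hI0 (hsI ▸ Multiset.prod_eq_zero hP)
  have hca : (∃ s : Multiset (Ideal D),
      (∀ P ∈ s, P.IsPrime ∧ IsDivisorial D P ∧ P * P = P) ∧ s.prod = I) →
      I * I = I ∧ IsDivisorial D I := by
    rintro ⟨s, hs, rfl⟩
    exact hPruf.prod_idempotent_isDivisorial s fun P hP => ⟨(hs P hP).2.2, (hs P hP).2.1⟩
  refine ⟨⟨fun h => hPruf.exists_multiset_prod_eq hfc hI0 h.1 h.2, ?_⟩, ⟨fun h => ?_, hca⟩⟩
  · rintro ⟨s, hs, hsI⟩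
    exact hca ⟨s, hbc s hs hsI, hsI⟩
  · obtain ⟨s, hs, hsI⟩ := hPruf.exists_multiset_prod_eq hfc hI0 h.1 h.2
    exact ⟨s, hbc s hs hsI, hsI⟩

end
end

section
/- Let ⋆ be a semistar operation on an integral domain D with quotient field K. Then for every nonzero D-submodule E of K, (Na(D,⋆) : E) ⊆ (D^⋆ : E)·Na(D,⋆), where the colon on the left and the product on the right are computed in the quotient field of D[X]. -/
/-! Statement 9: For a semistar operation ⋆ on D and every nonzero D-submodule E of K, (Na(D,⋆) : E) ⊆ (D^⋆ : E)·Na(D,⋆), computed in the quotient field of D[X]. -/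

open scoped Pointwise

noncomputable section

/-- A semistar operation on an integral domain `D` with quotient field `K`:
a map `E ↦ E^⋆` on nonzero `D`-submodules of `K` such that for all nonzero `x ∈ K`
and all nonzero `D`-submodules `E, F` of `K`:
`(xE)^⋆ = xE^⋆`; `E ⊆ F → E^⋆ ⊆ F^⋆`; `E ⊆ E^⋆`; and `(E^⋆)^⋆ = E^⋆`. -/
structure SemistarOp (D : Type*) [CommRing D] [IsDomain D] where
  star : Submodule D (FractionRing D) → Submodule D (FractionRing D)
  star_smul : ∀ x : FractionRing D, x ≠ 0 → ∀ E : Submodule D (FractionRing D), E ≠ ⊥ →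
    star (x • E) = x • star E
  star_mono : ∀ E F : Submodule D (FractionRing D), E ≠ ⊥ → F ≠ ⊥ → E ≤ F → star E ≤ star F
  le_star : ∀ E : Submodule D (FractionRing D), E ≠ ⊥ → E ≤ star E
  star_star : ∀ E : Submodule D (FractionRing D), E ≠ ⊥ → star (star E) = star E
/-- The natural embedding of the quotient field `K` of `D` into the quotient field `L`
of the polynomial ring `D[X]`. -/
def embK (D : Type*) [CommRing D] [IsDomain D] :
    FractionRing D →+* FractionRing (Polynomial D) :=
  IsFractionRing.lift
    (g := (algebraMap (Polynomial D) (FractionRing (Polynomial D))).comp Polynomial.C)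
    ((IsFractionRing.injective (Polynomial D) (FractionRing (Polynomial D))).comp
      (Polynomial.C_injective))

/-- The content `c(g)` of a polynomial `g ∈ D[X]`: the ideal of `D`
generated by the coefficients of `g`. -/
def contIdeal (D : Type*) [CommRing D] [IsDomain D] (g : Polynomial D) : Ideal D :=
  Ideal.span (Set.range g.coeff)

/-- `N(⋆) = {g ∈ D[X] : g ≠ 0 and c(g)^⋆ = D^⋆}`. -/
def Nstar (D : Type*) [CommRing D] [IsDomain D] (s : SemistarOp D) : Set (Polynomial D) :=
  {g | g ≠ 0 ∧ s.star (coeI D (contIdeal D g)) = s.star 1}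

/-- The semistar Nagata ring `Na(D,⋆) = D[X]_{N(⋆)}`, regarded as a subset of the
quotient field `L` of `D[X]`: the set of fractions `f / g` with `f ∈ D[X]`, `g ∈ N(⋆)`. -/
def NaSet (D : Type*) [CommRing D] [IsDomain D] (s : SemistarOp D) :
    Set (FractionRing (Polynomial D)) :=
  {x | ∃ f g : Polynomial D, g ∈ Nstar D s ∧
    x * algebraMap (Polynomial D) (FractionRing (Polynomial D)) g =
      algebraMap (Polynomial D) (FractionRing (Polynomial D)) f}

/-- The product `A·B` of two subsets of a commutative ring: the set of all finite sums of
products `a * b` with `a ∈ A`, `b ∈ B` (the additive submonoid generated by the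
pointwise product set). -/
def setMulSpan {R : Type*} [CommRing R] (A B : Set R) : Set R :=
  (AddSubmonoid.closure (A * B) : AddSubmonoid R)

open Polynomial

namespace Polynomial

variable (R : Type*) {A : Type*} [CommRing R] [CommRing A] [Algebra R A]

/-- The `R`-submodule of `A` generated by the coefficients of a polynomial over `A`. -/
def coeffSpan (p : A[X]) : Submodule R A :=
  Submodule.span R (Set.range p.coeff)

variable {R}

lemma coeff_mem_coeffSpan (p : A[X]) (i : ℕ) : p.coeff i ∈ coeffSpan R p :=
  Submodule.subset_span ⟨i, rfl⟩

lemma coeffSpan_le {p : A[X]} {M : Submodule R A} :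
    coeffSpan R p ≤ M ↔ ∀ i, p.coeff i ∈ M := by
  simp [coeffSpan, Submodule.span_le, Set.range_subset_iff]

lemma coeffSpan_eraseLead_le (p : A[X]) : coeffSpan R p.eraseLead ≤ coeffSpan R p := by
  refine coeffSpan_le.2 fun i => ?_
  rw [eraseLead_coeff]
  split_ifs
  · exact zero_mem _
  · exact coeff_mem_coeffSpan p i

lemma coeffSpan_le_eraseLead_add (p : A[X]) :
    coeffSpan R p ≤ coeffSpan R p.eraseLead + Submodule.span R {p.leadingCoeff} := by
  refine coeffSpan_le.2 fun i => ?_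
  by_cases hi : i = p.natDegree
  · subst hi
    exact Submodule.mem_sup_right (Submodule.mem_span_singleton_self _)
  · rw [← eraseLead_coeff_of_ne i hi]
    exact Submodule.mem_sup_left (coeff_mem_coeffSpan _ i)

lemma coeffSpan_mul_eraseLead_le (f h : A[X]) :
    coeffSpan R (f * h.eraseLead) ≤
      coeffSpan R (f * h) + Submodule.span R {h.leadingCoeff} * coeffSpan R f := by
  refine coeffSpan_le.2 fun i => ?_
  rw [← self_sub_C_mul_X_pow, mul_sub, coeff_sub]
  refine sub_mem (Submodule.mem_sup_left (coeff_mem_coeffSpan _ i)) (Submodule.mem_sup_right ?_)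
  rw [mul_left_comm, coeff_C_mul, coeff_mul_X_pow', mul_ite, mul_zero]
  split_ifs
  · exact Submodule.mul_mem_mul (Submodule.mem_span_singleton_self _) (coeff_mem_coeffSpan f _)
  · exact zero_mem _

lemma span_leadingCoeff_mul_le (f h : A[X]) :
    Submodule.span R {f.leadingCoeff} * Submodule.span R {h.leadingCoeff} ≤
      coeffSpan R (f * h) := by
  rw [Submodule.span_mul_span, Set.singleton_mul_singleton, Submodule.span_le,
    Set.singleton_subset_iff, ← coeff_mul_degree_add_degree]
  exact coeff_mem_coeffSpan _ _

lemma _root_.Submodule.add_pow_succ_le (M N : Submodule R A) (k : ℕ) :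
    (M + N) ^ (k + 1) ≤ M ^ (k + 1) + N * (M + N) ^ k := by
  induction k with
  | zero => simp
  | succ k ih =>
    have hM : M ≤ M + N := le_sup_left
    calc (M + N) ^ (k + 1 + 1) = (M + N) ^ (k + 1) * M + N * (M + N) ^ (k + 1) := by ring
      _ ≤ (M ^ (k + 1) + N * (M + N) ^ k) * M + N * (M + N) ^ (k + 1) := by gcongr
      _ = M ^ (k + 1 + 1) + (N * ((M + N) ^ k * M) + N * (M + N) ^ (k + 1)) := by ring
      _ ≤ M ^ (k + 1 + 1) + (N * ((M + N) ^ k * (M + N)) + N * (M + N) ^ (k + 1)) := by gcongr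
      _ = M ^ (k + 1 + 1) + N * (M + N) ^ (k + 1) := by
        rw [← pow_succ, Submodule.add_eq_sup (N * _), sup_idem]

/-- A form of the Dedekind–Mertens lemma, with the exponent given by the number of terms. -/
theorem coeffSpan_pow_mul_le (n : ℕ) (f h : A[X]) (hn : h.support.card ≤ n) :
    coeffSpan R f ^ (n + 1) * coeffSpan R h ≤ coeffSpan R f ^ n * coeffSpan R (f * h) := by
  induction n generalizing f h with
  | zero =>
    obtain rfl : h = 0 := by simpa using hn
    have : coeffSpan R (0 : A[X]) = ⊥ := le_bot_iff.1 (coeffSpan_le.2 fun i => by simp)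
    simp [this]
  | succ n ihn =>
    have hn' : h.eraseLead.support.card ≤ n := by
      rw [card_support_eraseLead]; omega
    have lead (f : A[X]) : Submodule.span R {f.leadingCoeff} *
        (coeffSpan R f ^ (n + 1) * coeffSpan R h) ≤
          coeffSpan R f ^ (n + 1) * coeffSpan R (f * h) := by
      have ih := ihn f h.eraseLead hn'
      have hB := coeffSpan_le_eraseLead_add (R := R) h
      have hC := coeffSpan_mul_eraseLead_le (R := R) f h
      have hab := span_leadingCoeff_mul_le (R := R) f h
      have ha : Submodule.span R {f.leadingCoeff} ≤ coeffSpan R f :=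
        (Submodule.span_singleton_le_iff_mem _ _).2 (coeff_mem_coeffSpan f _)
      generalize Submodule.span R {f.leadingCoeff} = a at *
      generalize Submodule.span R {h.leadingCoeff} = b at *
      generalize coeffSpan R (f * h) = C at *
      generalize coeffSpan R (f * h.eraseLead) = C' at *
      generalize coeffSpan R f = F at *
      generalize coeffSpan R h = B at *
      generalize coeffSpan R h.eraseLead = B' at *
      calc a * (F ^ (n + 1) * B) ≤ a * (F ^ (n + 1) * (B' + b)) := by gcongr
        _ = a * (F ^ (n + 1) * B') + F ^ (n + 1) * (a * b) := by ring
        _ ≤ a * (F ^ n * (C + b * F)) + F ^ (n + 1) * C := 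
          add_le_add (mul_le_mul' le_rfl (ih.trans (mul_le_mul' le_rfl hC)))
            (mul_le_mul' le_rfl hab)
        _ = F ^ n * a * C + F ^ (n + 1) * (a * b) + F ^ (n + 1) * C := by ring
        _ ≤ F ^ n * F * C + F ^ (n + 1) * C + F ^ (n + 1) * C := by gcongr
        _ = F ^ (n + 1) * C := by
          rw [← pow_succ]; simp only [Submodule.add_eq_sup, sup_idem]
    induction hm : f.support.card generalizing f with
    | zero =>
      obtain rfl : f = 0 := by simpa using hm
      have : coeffSpan R (0 : A[X]) = ⊥ := le_bot_iff.1 (coeffSpan_le.2 fun i => by simp)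
      simp [this]
    | succ m ihm =>
      have ih := ihm f.eraseLead (card_support_eraseLead' hm)
      have hC : coeffSpan R (f.eraseLead * h) ≤
          coeffSpan R (f * h) + Submodule.span R {f.leadingCoeff} * coeffSpan R h := by
        simpa only [mul_comm] using coeffSpan_mul_eraseLead_le (R := R) h f
      have hF := coeffSpan_eraseLead_le (R := R) f
      have hF' : coeffSpan R f = coeffSpan R f.eraseLead + Submodule.span R {f.leadingCoeff} :=
        le_antisymm (coeffSpan_le_eraseLead_add f) (sup_le hF
          ((Submodule.span_singleton_le_iff_mem _ _).2 (coeff_mem_coeffSpan f _)))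
      have hl := lead f
      have hp := Submodule.add_pow_succ_le (coeffSpan R f.eraseLead)
        (Submodule.span R {f.leadingCoeff}) (n + 1)
      rw [← hF'] at hp
      clear hF' ihm lead ihn
      generalize Submodule.span R {f.leadingCoeff} = a at *
      generalize coeffSpan R (f * h) = C at *
      generalize coeffSpan R (f.eraseLead * h) = C' at *
      generalize coeffSpan R f = F at *
      generalize coeffSpan R h = B at *
      generalize coeffSpan R f.eraseLead = F' at *
      calc F ^ (n + 1 + 1) * B ≤ (F' ^ (n + 1 + 1) + a * F ^ (n + 1)) * B := by gcongr
        _ = F' ^ (n + 1 + 1) * B + a * (F ^ (n + 1) * B) := by ring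
        _ ≤ F ^ (n + 1) * (C + a * B) + F ^ (n + 1) * C := 
          add_le_add (ih.trans (mul_le_mul' (pow_le_pow_left' hF _) hC)) hl
        _ = F ^ (n + 1) * C + a * (F ^ (n + 1) * B) + F ^ (n + 1) * C := by ring
        _ ≤ F ^ (n + 1) * C + F ^ (n + 1) * C + F ^ (n + 1) * C := by gcongr
        _ = F ^ (n + 1) * C := by simp only [Submodule.add_eq_sup, sup_idem]

lemma coeffSpan_map_le_one (p : R[X]) : coeffSpan R (p.map (algebraMap R A)) ≤ 1 :=
  coeffSpan_le.2 fun i => by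
    rw [coeff_map]
    exact Submodule.algebraMap_mem _

end Polynomial

section

variable {D : Type*} [CommRing D] [IsDomain D]

lemma coeI_contIdeal (g : D[X]) :
    coeI D (contIdeal D g) = coeffSpan D (g.map (algebraMap D (FractionRing D))) := by
  rw [coeI, contIdeal, Ideal.span, Submodule.map_span, coeffSpan, ← Set.range_comp]
  congr 2
  ext i
  simp

lemma SemistarOp.one_le_star_one (s : SemistarOp D) : 1 ≤ s.star 1 :=
  s.le_star 1 (one_ne_zero (α := Submodule D (FractionRing D)))

lemma SemistarOp.le_star_one_of_mul_le (s : SemistarOp D)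
    {J B : Submodule D (FractionRing D)} (hJ : J ≠ ⊥) (hJs : s.star J = s.star 1)
    (h : J * B ≤ s.star 1) : B ≤ s.star 1 := by
  have h1 : (1 : Submodule D (FractionRing D)) ≠ ⊥ :=
    one_ne_zero (α := Submodule D (FractionRing D))
  have hs1 : s.star 1 ≠ ⊥ := ne_bot_of_le_ne_bot h1 s.one_le_star_one
  intro b hb
  by_cases hb0 : b = 0
  · exact hb0 ▸ zero_mem _
  have hbJ : b • J ≤ s.star 1 := by
    rintro _ ⟨j, hj, rfl⟩
    have := h (Submodule.mul_mem_mul hj hb)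
    rwa [mul_comm] at this
  have hbJ0 : b • J ≠ ⊥ := by
    obtain ⟨j, hj, hj0⟩ := Submodule.exists_mem_ne_zero_of_ne_bot hJ
    exact (Submodule.ne_bot_iff _).2
      ⟨b • j, Submodule.smul_mem_pointwise_smul j b J hj, smul_ne_zero hb0 hj0⟩
  have hle := s.star_mono _ _ hbJ0 hs1 hbJ
  rw [s.star_smul b hb0 J hJ, s.star_star 1 h1, hJs] at hle
  have := hle (Submodule.smul_mem_pointwise_smul 1 b _
    (s.one_le_star_one (Submodule.one_le.1 le_rfl)))
  simpa using this

lemma SemistarOp.le_star_one_of_pow_mul_le (s : SemistarOp D)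
    {J B : Submodule D (FractionRing D)} (hJ : J ≠ ⊥) (hJs : s.star J = s.star 1) (n : ℕ)
    (h : J ^ n * B ≤ s.star 1) : B ≤ s.star 1 := by
  induction n with
  | zero => simpa using h
  | succ n ih =>
    refine ih (s.le_star_one_of_mul_le hJ hJs ?_)
    rwa [← mul_assoc, ← pow_succ']

/-- If `g ∈ N(⋆)` and `g * h` has coefficients in `D`, then `h` has coefficients in `D^⋆`. -/
lemma coeff_mem_star_one (s : SemistarOp D) {g : D[X]} (hg : g ∈ Nstar D s)
    {h : (FractionRing D)[X]} {f : D[X]}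
    (hf : g.map (algebraMap D (FractionRing D)) * h = f.map (algebraMap D (FractionRing D)))
    (i : ℕ) : h.coeff i ∈ s.star 1 := by
  obtain ⟨hg0, hgs⟩ := hg
  rw [coeI_contIdeal] at hgs
  refine s.le_star_one_of_pow_mul_le ?_ hgs (h.support.card + 1) ?_ (coeff_mem_coeffSpan h i)
  · intro hbot
    refine hg0 (Polynomial.ext fun j => ?_)
    have := coeff_mem_coeffSpan (R := D) (g.map (algebraMap D (FractionRing D))) j
    rw [hbot, Submodule.mem_bot, coeff_map] at this
    simpa using this
  · refine (coeffSpan_pow_mul_le _ _ h le_rfl).trans (le_trans ?_ s.one_le_star_one)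
    rw [hf]
    calc _ ≤ (1 : Submodule D (FractionRing D)) ^ h.support.card * 1 := by
          gcongr <;> exact coeffSpan_map_le_one _
      _ = 1 := by simp

/-- The embedding of `K[X]` into the quotient field of `D[X]`. -/
def embPoly (D : Type*) [CommRing D] [IsDomain D] :
    (FractionRing D)[X] →+* FractionRing D[X] :=
  eval₂RingHom (embK D) (algebraMap D[X] (FractionRing D[X]) X)

lemma embK_algebraMap (d : D) :
    embK D (algebraMap D (FractionRing D) d) = algebraMap D[X] (FractionRing D[X]) (C d) := by
  simp [embK]

lemma embPoly_C (a : FractionRing D) : embPoly D (C a) = embK D a := by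
  simp [embPoly]

lemma embPoly_map (p : D[X]) :
    embPoly D (p.map (algebraMap D (FractionRing D))) =
      algebraMap D[X] (FractionRing D[X]) p := by
  have : (embPoly D).comp (mapRingHom (algebraMap D (FractionRing D))) =
      algebraMap D[X] (FractionRing D[X]) := by
    refine Polynomial.ringHom_ext (fun d => ?_) ?_
    · simp [embPoly_C, embK_algebraMap]
    · simp [embPoly]
  exact RingHom.congr_fun this p

lemma embPoly_injective : Function.Injective (embPoly D) := by
  refine (injective_iff_map_eq_zero _).2 fun p hp => ?_
  obtain ⟨b, hb0, hb⟩ := IsLocalization.integerNormalization_spec (nonZeroDivisors D) p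
  have hbp : b • p = C (algebraMap D (FractionRing D) b) * p := by
    rw [← smul_eq_C_mul, algebraMap_smul]
  have h0 := congrArg (embPoly D) hb
  erw [embPoly_map, hbp] at h0
  rw [map_mul, hp, mul_zero, map_eq_zero_iff _ (IsFractionRing.injective _ _)] at h0
  rw [h0, Polynomial.map_zero, hbp, eq_comm, mul_eq_zero, C_eq_zero] at hb
  exact hb.resolve_left (by simpa using nonZeroDivisors.ne_zero hb0)

end

theorem statement9 (D : Type*) [CommRing D] [IsDomain D] (s : SemistarOp D)
    (E : Submodule D (FractionRing D)) (hE : E ≠ ⊥) :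
    -- `(Na(D,⋆) : E) = {x ∈ L : xE ⊆ Na(D,⋆)}` ...
    {x : FractionRing (Polynomial D) |
        ∀ y ∈ embK D '' (E : Set (FractionRing D)), x * y ∈ NaSet D s} ⊆
      -- ... is contained in `(D^⋆ : E)·Na(D,⋆)`, where `(D^⋆ : E) = {x ∈ K : xE ⊆ D^⋆}`.
      setMulSpan
        (embK D '' ((s.star 1 / E : Submodule D (FractionRing D)) : Set (FractionRing D)))
        (NaSet D s) := by
  intro x hx
  obtain ⟨e, he, he0⟩ := Submodule.exists_mem_ne_zero_of_ne_bot hE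
  obtain ⟨f, g, hg, hfg⟩ := hx _ ⟨e, he, rfl⟩
  have he0' : embK D e ≠ 0 := (_root_.map_ne_zero _).2 he0
  have hg0 : algebraMap D[X] (FractionRing D[X]) g ≠ 0 :=
    (map_ne_zero_iff _ (IsFractionRing.injective _ _)).2 hg.1
  set h : (FractionRing D)[X] := C e⁻¹ * f.map (algebraMap D (FractionRing D)) with hh
  have hφ : embPoly D h = x * algebraMap D[X] (FractionRing D[X]) g := by
    rw [hh, map_mul, embPoly_map, embPoly_C, ← hfg, map_inv₀]
    field_simp
  have hcoeff (i : ℕ) : h.coeff i ∈ s.star 1 / E := by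
    refine Submodule.mem_div_iff_forall_mul_mem.2 fun y hy => ?_
    obtain ⟨f', g', hg', hfg'⟩ := hx _ ⟨y, hy, rfl⟩
    rw [← coeff_mul_C]
    refine coeff_mem_star_one s hg' (f := f' * g) (embPoly_injective ?_) i
    rw [map_mul, map_mul, hφ, embPoly_map, embPoly_map, embPoly_C, map_mul, ← hfg']
    ring
  have hxsum : x = ∑ i ∈ h.support, embK D (h.coeff i) *
      (algebraMap D[X] (FractionRing D[X]) (X ^ i) /
        algebraMap D[X] (FractionRing D[X]) g) := by
    rw [eq_div_of_mul_eq hg0 hφ.symm, embPoly, coe_eval₂RingHom, eval₂_eq_sum,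
      Polynomial.sum, Finset.sum_div]
    exact Finset.sum_congr rfl fun i _ => by rw [map_pow, mul_div_assoc]
  rw [hxsum]
  refine sum_mem fun i _ => AddSubmonoid.subset_closure
    (Set.mul_mem_mul ⟨_, hcoeff i, rfl⟩ ⟨X ^ i, g, hg, ?_⟩)
  rw [div_mul_cancel₀ _ hg0]

end
end
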